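/- There exists a constant C > 0 depending only on P such that for every admissible prime p and all 1-bounded functions f0, f1 : F_p^2 → ℂ, the average 𝔼_{x1,x2,y} f0(x1,x2) f1(x1,x2+P(y)) equals 𝔼_{x1,x2} ( f0(x1,x2) · 𝔼_a f1(x1,a) ) up to an error of absolute value at most C · p^{-1/2}. -/

import Mathlib

open scoped BigOperators ComplexOrder
open Polynomial

noncomputable section

namespace RatCorners

/-- Reduction of a rational number modulo `p` (genuine when `p` does not divide the
denominator). -/
def ratRed (p : ℕ) (q : ℚ) : ZMod p := (q.num : ZMod p) * (q.den : ZMod p)⁻¹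

/-- Coefficientwise reduction of a polynomial with rational coefficients modulo `p`. -/
def polyRed (p : ℕ) (f : Polynomial ℚ) : Polynomial (ZMod p) :=
  f.sum fun n a => Polynomial.C (ratRed p a) * Polynomial.X ^ n

/-- `p` divides no denominator of any coefficient of `P` (with numerator and denominator
of `P` in lowest terms). -/
def Admissible (p : ℕ) (P : RatFunc ℚ) : Prop :=
  (∀ n, ¬ p ∣ (P.num.coeff n).den) ∧ ∀ n, ¬ p ∣ (P.denom.coeff n).den

/-- `y` is a pole of the reduction of `P` modulo `p`. -/
def IsPole (p : ℕ) (P : RatFunc ℚ) (y : ZMod p) : Prop :=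
  (polyRed p P.denom).eval y = 0

instance (p : ℕ) (P : RatFunc ℚ) : DecidablePred (IsPole p P) := fun y =>
  inferInstanceAs (Decidable ((polyRed p P.denom).eval y = 0))

/-- Evaluation of the reduction of `P` modulo `p` at `y` (junk value `0` at poles). -/
def evalRed (p : ℕ) (P : RatFunc ℚ) (y : ZMod p) : ZMod p :=
  (polyRed p P.num).eval y * ((polyRed p P.denom).eval y)⁻¹

/-- A function is `1`-bounded if all its values have norm at most `1`. -/
def OneBounded {α : Type*} (f : α → ℂ) : Prop := ∀ x, ‖f x‖ ≤ 1

/-- The formal derivative of a rational function. -/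
def ratDeriv (P : RatFunc ℚ) : RatFunc ℚ :=
  algebraMap (Polynomial ℚ) (RatFunc ℚ)
      (Polynomial.derivative P.num * P.denom - P.num * Polynomial.derivative P.denom) /
    algebraMap (Polynomial ℚ) (RatFunc ℚ) (P.denom ^ 2)

/-- Substitution of the variable `y i` into a rational function `P ∈ ℚ(t)`, producing an
element of the rational function field `ℚ(y 0, …, y (n-1))`. -/
def substAt {n : ℕ} (P : RatFunc ℚ) (i : Fin n) : FractionRing (MvPolynomial (Fin n) ℚ) :=
  Polynomial.eval₂
      ((algebraMap (MvPolynomial (Fin n) ℚ) (FractionRing (MvPolynomial (Fin n) ℚ))).comp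
        MvPolynomial.C)
      (algebraMap (MvPolynomial (Fin n) ℚ) (FractionRing (MvPolynomial (Fin n) ℚ))
        (MvPolynomial.X i)) P.num /
    Polynomial.eval₂
      ((algebraMap (MvPolynomial (Fin n) ℚ) (FractionRing (MvPolynomial (Fin n) ℚ))).comp
        MvPolynomial.C)
      (algebraMap (MvPolynomial (Fin n) ℚ) (FractionRing (MvPolynomial (Fin n) ℚ))
        (MvPolynomial.X i)) P.denom

variable (p : ℕ) [NeZero p]

/-- The counting operator `𝔼_{x₁,x₂,y} f₀(x₁,x₂) f₁(x₁+P(y),x₂) f₂(x₁,x₂+Q(y))`,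
where the average in `y` avoids the poles of `P` and `Q` but is still normalized by `1/p`. -/
def cornerAvg (P Q : RatFunc ℚ) (f0 f1 f2 : ZMod p × ZMod p → ℂ) : ℂ :=
  (p : ℂ)⁻¹ ^ 3 * ∑ x1 : ZMod p, ∑ x2 : ZMod p, ∑ y : ZMod p,
    if ¬ IsPole p P y ∧ ¬ IsPole p Q y then
      f0 (x1, x2) * f1 (x1 + evalRed p P y, x2) * f2 (x1, x2 + evalRed p Q y)
    else 0

/-- The main term `𝔼_{x₁,x₂} f₀(x₁,x₂) · 𝔼_a f₁(a,x₂) · 𝔼_b f₂(x₁,b)`. -/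
def mainTerm (f0 f1 f2 : ZMod p × ZMod p → ℂ) : ℂ :=
  (p : ℂ)⁻¹ ^ 2 * ∑ x1 : ZMod p, ∑ x2 : ZMod p,
    f0 (x1, x2) * ((p : ℂ)⁻¹ * ∑ a : ZMod p, f1 (a, x2)) *
      ((p : ℂ)⁻¹ * ∑ b : ZMod p, f2 (x1, b))

/-- The `L^r` norm with respect to the uniform probability measure on `(ZMod p)²`. -/
def Lnorm (r : ℝ) (f : ZMod p × ZMod p → ℂ) : ℝ :=
  ((p : ℝ)⁻¹ ^ 2 * ∑ x : ZMod p × ZMod p, ‖f x‖ ^ r) ^ r⁻¹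

/-- The Gowers norm `‖f‖_{U²(0×F_p)}` along the second coordinate axis. -/
def U2vert (f : ZMod p × ZMod p → ℂ) : ℝ :=
  ((p : ℝ)⁻¹ ^ 4 * (∑ x : ZMod p × ZMod p, ∑ h : ZMod p, ∑ k : ZMod p,
      f x * (starRingEnd ℂ) (f (x + (0, h))) * (starRingEnd ℂ) (f (x + (0, k))) *
        f (x + (0, h + k))).re) ^ ((4:ℝ)⁻¹)

/-- The Gowers norm `‖f‖_{U²(F_p×0)}` along the first coordinate axis. -/
def U2horiz (f : ZMod p × ZMod p → ℂ) : ℝ :=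
  ((p : ℝ)⁻¹ ^ 4 * (∑ x : ZMod p × ZMod p, ∑ h : ZMod p, ∑ k : ZMod p,
      f x * (starRingEnd ℂ) (f (x + (h, 0))) * (starRingEnd ℂ) (f (x + (k, 0))) *
        f (x + (h + k, 0))).re) ^ ((4:ℝ)⁻¹)

/-- The additive character `e_p(x) = e^{2πix/p}` on `ZMod p`. -/
def ep (x : ZMod p) : ℂ := Complex.exp (2 * Real.pi * Complex.I * (x.val : ℂ) / (p : ℂ))

/-- `e(r) = e^{2πir}` for a real number `r`. -/
def eC (r : ℝ) : ℂ := Complex.exp (2 * Real.pi * Complex.I * (r : ℂ))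

/-- The Fourier transform `f̂(ξ) = 𝔼_x f(x) e_p(−x·ξ)` on `(ZMod p)²`. -/
def dft (f : ZMod p × ZMod p → ℂ) (ξ : ZMod p × ZMod p) : ℂ :=
  (p : ℂ)⁻¹ ^ 2 * ∑ x : ZMod p × ZMod p, f x * ep p (-(x.1 * ξ.1 + x.2 * ξ.2))

/-- `F₁(n₁,𝐡) = ∑_{n₂} Δ_{−𝐡} f̂₁(n₁,n₂)` where `Δ_h g(x) = g(x)·conj g(x+h)`. -/
def F1 (f : ZMod p × ZMod p → ℂ) (n1 : ZMod p) (h : ZMod p × ZMod p) : ℂ :=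
  ∑ n2 : ZMod p, dft p f (n1, n2) * (starRingEnd ℂ) (dft p f ((n1, n2) + -h))

/-- `F₂(m₂,𝐡) = ∑_{m₁} Δ_{𝐡} f̂₂(m₁,m₂)` where `Δ_h g(x) = g(x)·conj g(x+h)`. -/
def F2 (f : ZMod p × ZMod p → ℂ) (m2 : ZMod p) (h : ZMod p × ZMod p) : ℂ :=
  ∑ m1 : ZMod p, dft p f (m1, m2) * (starRingEnd ℂ) (dft p f ((m1, m2) + h))

/-- The `F_p`-points of the Roth variety for corners associated to `P, Q`:
tuples `(y₁,…,y₁₆)` (indexed here by `0,…,15`) avoiding all poles of `P` and `Q` and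
satisfying the ten defining equations. -/
def IsRothPoint (P Q : RatFunc ℚ) (y : Fin 16 → ZMod p) : Prop :=
  (∀ i, ¬ IsPole p P (y i)) ∧ (∀ i, ¬ IsPole p Q (y i)) ∧
  evalRed p P (y 0) - evalRed p P (y 2) - evalRed p P (y 8) + evalRed p P (y 10) = 0 ∧
  evalRed p P (y 1) - evalRed p P (y 3) - evalRed p P (y 9) + evalRed p P (y 11) = 0 ∧
  evalRed p P (y 4) - evalRed p P (y 6) - evalRed p P (y 12) + evalRed p P (y 14) = 0 ∧
  evalRed p P (y 5) - evalRed p P (y 7) - evalRed p P (y 13) + evalRed p P (y 15) = 0 ∧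
  evalRed p Q (y 0) - evalRed p Q (y 1) - evalRed p Q (y 8) + evalRed p Q (y 9) = 0 ∧
  evalRed p Q (y 2) - evalRed p Q (y 6) - evalRed p Q (y 10) + evalRed p Q (y 14) = 0 ∧
  evalRed p Q (y 3) - evalRed p Q (y 7) - evalRed p Q (y 11) + evalRed p Q (y 15) = 0 ∧
  evalRed p Q (y 4) - evalRed p Q (y 5) - evalRed p Q (y 12) + evalRed p Q (y 13) = 0 ∧
  evalRed p P (y 8) - evalRed p P (y 9) - evalRed p P (y 10) + evalRed p P (y 11) -
      evalRed p P (y 12) + evalRed p P (y 13) + evalRed p P (y 14) - evalRed p P (y 15) = 0 ∧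
  evalRed p Q (y 8) - evalRed p Q (y 9) - evalRed p Q (y 10) + evalRed p Q (y 11) -
      evalRed p Q (y 12) + evalRed p Q (y 13) + evalRed p Q (y 14) - evalRed p Q (y 15) = 0

/-- `|Y(F_p)|`, the number of `F_p`-points of the Roth variety for corners. -/
def rothCard (P Q : RatFunc ℚ) : ℕ :=
  Nat.card {y : Fin 16 → ZMod p // IsRothPoint p P Q y}

/-- `χ` is an eigenfunction with respect to the first coordinate:
`χ(x₁,x₂) = 1_E(x₂) e_p(φ(x₂)x₁) e(ψ(x₂))`. -/
def IsEigen1 (χ : ZMod p × ZMod p → ℂ) : Prop :=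
  ∃ (E : Finset (ZMod p)) (φ : ZMod p → ZMod p) (ψ : ZMod p → ℝ),
    ∀ x1 x2 : ZMod p,
      χ (x1, x2) = (if x2 ∈ E then 1 else 0) * ep p (φ x2 * x1) * eC (ψ x2)

/-- `χ` is an eigenfunction with respect to the second coordinate:
`χ(x₁,x₂) = 1_E(x₁) e_p(φ(x₁)x₂) e(ψ(x₁))`. -/
def IsEigen2 (χ : ZMod p × ZMod p → ℂ) : Prop :=
  ∃ (E : Finset (ZMod p)) (φ : ZMod p → ZMod p) (ψ : ZMod p → ℝ),
    ∀ x1 x2 : ZMod p,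
      χ (x1, x2) = (if x1 ∈ E then 1 else 0) * ep p (φ x1 * x2) * eC (ψ x1)

/-- The two-term counting operator `𝔼_{x₁,x₂,y} f₀(x₁,x₂) f₁(x₁+P(y),x₂)`. -/
def twoAvg1 (P : RatFunc ℚ) (f0 f1 : ZMod p × ZMod p → ℂ) : ℂ :=
  (p : ℂ)⁻¹ ^ 3 * ∑ x1 : ZMod p, ∑ x2 : ZMod p, ∑ y : ZMod p,
    if ¬ IsPole p P y then f0 (x1, x2) * f1 (x1 + evalRed p P y, x2) else 0

/-- The two-term counting operator `𝔼_{x₁,x₂,y} f₀(x₁,x₂) f₁(x₁,x₂+P(y))`. -/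
def twoAvg2 (P : RatFunc ℚ) (f0 f1 : ZMod p × ZMod p → ℂ) : ℂ :=
  (p : ℂ)⁻¹ ^ 3 * ∑ x1 : ZMod p, ∑ x2 : ZMod p, ∑ y : ZMod p,
    if ¬ IsPole p P y then f0 (x1, x2) * f1 (x1, x2 + evalRed p P y) else 0

theorem exists_large_pow_near_one {ι : Type*} [Fintype ι] (u : ι → ℂ) (hu : ∀ i, ‖u i‖ = 1)
    (N : ℕ) : ∃ m, N ≤ m ∧ ∀ i, ‖u i ^ m - 1‖ ≤ 1 / 2 := by
  have hb : ∀ k : ℕ, (fun i => u i ^ (N * k)) ∈ Metric.closedBall (0 : ι → ℂ) 1 := by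
    intro k
    rw [mem_closedBall_zero_iff, pi_norm_le_iff_of_nonneg zero_le_one]
    intro i
    rw [norm_pow, hu, one_pow]
  obtain ⟨l, -, φ, hφ, hl⟩ := tendsto_subseq_of_bounded Metric.isBounded_closedBall hb
  obtain ⟨K, hK⟩ := Metric.cauchySeq_iff'.1 hl.cauchySeq (1 / 2) (by norm_num)
  have h1 := hK (K + 1) (Nat.le_succ K)
  have hlt : φ K < φ (K + 1) := hφ (Nat.lt_succ_self K)
  refine ⟨N * (φ (K + 1) - φ K), Nat.le_mul_of_pos_right _ (Nat.sub_pos_of_lt hlt), fun i => ?_⟩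
  have h2 := (dist_le_pi_dist _ _ i).trans h1.le
  simp only [Function.comp, dist_eq_norm] at h2
  have h3 : u i ^ (N * φ (K + 1)) - u i ^ (N * φ K)
      = u i ^ (N * φ K) * (u i ^ (N * (φ (K + 1) - φ K)) - 1) := by
    rw [mul_sub, ← pow_add, ← mul_add, Nat.add_sub_cancel' hlt.le, mul_one]
  rwa [h3, norm_mul, norm_pow, hu, one_pow, one_mul] at h2

theorem norm_le_of_powerSum_bound (s : Multiset ℂ) (C B : ℝ) (hB : 0 < B)
    (h : ∀ m : ℕ, 1 ≤ m → ‖(s.map (· ^ m)).sum‖ ≤ C * B ^ m) : ∀ z ∈ s, ‖z‖ ≤ B := by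
  intro z hz
  by_contra! hlt
  have hz1 : 1 < ‖z‖ / B := (one_lt_div hB).2 hlt
  obtain ⟨N, hN⟩ := pow_unbounded_of_one_lt (2 * C) hz1
  obtain ⟨m, hm, hu⟩ := exists_large_pow_near_one
    (fun w : s.toFinset => if (w : ℂ) = 0 then 1 else (w : ℂ) / (‖(w : ℂ)‖ : ℂ)) (by
      intro w
      split_ifs with hw
      · simp
      · rw [norm_div, Complex.norm_real, norm_norm, div_self (norm_ne_zero_iff.2 hw)]) (N + 1)
  have key : ∀ w ∈ s, (1 / 2) * ‖w‖ ^ m ≤ (w ^ m).re := by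
    intro w hw
    by_cases hw0 : w = 0
    · simp [hw0, show m ≠ 0 by omega]
    have h1 := hu ⟨w, Multiset.mem_toFinset.2 hw⟩
    simp only [hw0, if_false] at h1
    have h2 : 1 / 2 ≤ (((w / (‖w‖ : ℂ)) ^ m)).re := by
      have := (Complex.abs_re_le_norm _).trans h1
      rw [abs_le, Complex.sub_re, Complex.one_re] at this
      linarith [this.1]
    have h3 : w ^ m = ((‖w‖ ^ m : ℝ) : ℂ) * (w / (‖w‖ : ℂ)) ^ m := by
      have : (‖w‖ : ℂ) ≠ 0 := by exact_mod_cast norm_ne_zero_iff.2 hw0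
      push_cast
      rw [← mul_pow, mul_div_cancel₀ _ this]
    rw [h3, Complex.re_ofReal_mul, mul_comm]
    exact mul_le_mul_of_nonneg_left h2 (by positivity)
  have hsum : (1 / 2) * ‖z‖ ^ m ≤ ((s.map (· ^ m)).sum).re := by
    have e : ((s.map (· ^ m)).sum).re = (s.map (fun w => (w ^ m).re)).sum := by
      rw [← Complex.coe_reAddGroupHom, map_multiset_sum, Multiset.map_map]
      rfl
    rw [e]
    refine (key z hz).trans ?_
    refine Multiset.single_le_sum ?_ _ (Multiset.mem_map_of_mem _ hz)
    intro x hx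
    obtain ⟨w, hw, rfl⟩ := Multiset.mem_map.1 hx
    exact le_trans (by positivity) (key w hw)
  have h4 := hsum.trans ((Complex.re_le_norm _).trans (h m (by omega)))
  have h5 : (‖z‖ / B) ^ N ≤ (‖z‖ / B) ^ m := pow_le_pow_right₀ hz1.le (by omega)
  have h6 : 2 * C < (‖z‖ / B) ^ m := hN.trans_le h5
  rw [div_pow, lt_div_iff₀ (by positivity)] at h6
  linarith

theorem exists_multiset_factorization (q : ℂ[X]) (hq : q.coeff 0 = 1) :
    ∃ s : Multiset ℂ, s.card ≤ q.natDegree ∧ q = (s.map fun w => 1 - C w * X).prod := by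
  induction hn : q.natDegree generalizing q with
  | zero =>
    refine ⟨0, by simp, ?_⟩
    rw [eq_C_of_natDegree_eq_zero hn, hq]
    simp
  | succ n ih =>
    obtain ⟨z, hz⟩ := IsAlgClosed.exists_root q (by
      intro h
      simp [natDegree_eq_of_degree_eq_some h] at hn)
    obtain ⟨r, hr⟩ := dvd_iff_isRoot.2 hz
    have hz0 : z ≠ 0 := by
      rintro rfl
      rw [hr] at hq
      simp at hq
    have hr' : q = (1 - C z⁻¹ * X) * (C (-z) * r) := by
      rw [hr, ← mul_assoc]
      congr 1
      have : C z⁻¹ * C z = 1 := by rw [← C_mul, inv_mul_cancel₀ hz0, C_1]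
      rw [C_neg]
      linear_combination (-X) * this
    have hdeg : (C (-z) * r).natDegree = n := by
      rw [natDegree_C_mul (neg_ne_zero.2 hz0)]
      have hr0 : r ≠ 0 := by
        rintro rfl
        simp [hr] at hn
      rw [hr, natDegree_mul (X_sub_C_ne_zero z) hr0, natDegree_X_sub_C] at hn
      omega
    obtain ⟨s, hs, hprod⟩ := ih (C (-z) * r) (by
      have := congrArg (fun f => f.coeff 0) hr'
      simp only [mul_coeff_zero, coeff_sub, coeff_C_zero] at this
      rw [hq] at this
      simp at this ⊢
      exact this.symm) hdeg
    refine ⟨z⁻¹ ::ₘ s, by simpa using hs, ?_⟩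
    rw [Multiset.map_cons, Multiset.prod_cons, ← hprod]
    exact hr'

theorem powerSeries_mk_geometric (w : ℂ) :
    (1 - PowerSeries.C w * PowerSeries.X) *
      PowerSeries.mk (fun n => if n = 0 then 0 else w ^ n) = PowerSeries.C w * PowerSeries.X := by
  ext n
  rcases n with - | n
  · simp
  · rw [sub_mul, one_mul, mul_assoc, map_sub, PowerSeries.coeff_C_mul, PowerSeries.coeff_C_mul,
      PowerSeries.coeff_succ_X_mul, PowerSeries.coeff_mk, PowerSeries.coeff_mk,
      PowerSeries.coeff_X]
    rcases n with - | n
    · simp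
    · simp [pow_succ']

theorem powerSum_derivative (s : Multiset ℂ) :
    PowerSeries.X * PowerSeries.derivative ℂ
        (s.map fun w => 1 - PowerSeries.C w * PowerSeries.X).prod
      = - PowerSeries.mk (fun n => if n = 0 then 0 else (s.map (· ^ n)).sum) *
        (s.map fun w => 1 - PowerSeries.C w * PowerSeries.X).prod := by
  induction s using Multiset.induction_on with
  | empty =>
    have : PowerSeries.mk (fun _ : ℕ => (0 : ℂ)) = 0 := by ext; simp
    simp [this]
  | cons w s ih =>
    set L := (s.map fun w => 1 - PowerSeries.C w * PowerSeries.X).prod with hL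
    have e : PowerSeries.mk (fun n => if n = 0 then 0 else ((w ::ₘ s).map (· ^ n)).sum)
        = PowerSeries.mk (fun n => if n = 0 then 0 else w ^ n)
          + PowerSeries.mk (fun n => if n = 0 then 0 else (s.map (· ^ n)).sum) := by
      ext n
      by_cases hn : n = 0 <;> simp [hn]
    have hd : PowerSeries.derivative ℂ (1 - PowerSeries.C w * PowerSeries.X)
        = - PowerSeries.C w := by
      rw [map_sub, Derivation.leibniz]
      simp [PowerSeries.derivative_C, PowerSeries.derivative_X]
    rw [Multiset.map_cons, Multiset.prod_cons, ← hL, Derivation.leibniz, hd, e, smul_eq_mul,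
      smul_eq_mul]
    linear_combination (1 - PowerSeries.C w * PowerSeries.X) * ih
      + L * powerSeries_mk_geometric w

theorem norm_le_of_newton_recurrence (A S : ℕ → ℂ) (k : ℕ) (hA0 : A 0 = 1)
    (hA : ∀ d, k ≤ d → A d = 0)
    (hrec : ∀ d : ℕ, (d : ℂ) * A d =
      ∑ n ∈ Finset.Icc 1 d, S n * A (d - n))
    (M B : ℝ) (hB : 0 < B) (hS : ∀ m : ℕ, 1 ≤ m → ‖S (2 * m)‖ ≤ M * B ^ m) :
    ‖S 1‖ ≤ k * √B := by
  have hk : k ≠ 0 := by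
    rintro rfl
    simp [hA 0 le_rfl] at hA0
  set q : ℂ[X] := ∑ d ∈ Finset.range k, C (A d) * X ^ d with hq
  have hcoeff : ∀ d, q.coeff d = A d := by
    intro d
    rw [hq, finsetSum_coeff]
    simp only [coeff_C_mul_X_pow]
    rw [Finset.sum_ite_eq]
    split_ifs with h
    · rfl
    · rw [hA d (by simpa using h)]
  obtain ⟨s, hs, hprod⟩ := exists_multiset_factorization q (by rw [hcoeff, hA0])
  have hdeg : q.natDegree ≤ k := by
    rw [natDegree_le_iff_coeff_eq_zero]
    intro N hN
    rw [hcoeff, hA N hN.le]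
  set L : PowerSeries ℂ := (s.map fun w => 1 - PowerSeries.C w * PowerSeries.X).prod with hL
  have hLq : L = (q : PowerSeries ℂ) := by
    rw [hprod, hL, ← Polynomial.coeToPowerSeries.ringHom_apply, map_multiset_prod,
      Multiset.map_map]
    congr 2
    ext1 w
    simp
  have hL0 : L ≠ 0 := by
    intro h
    have := congrArg (PowerSeries.coeff 0) h
    rw [hLq, Polynomial.coeff_coe, hcoeff, hA0] at this
    simp at this
  have h1 : PowerSeries.X * PowerSeries.derivative ℂ L
      = PowerSeries.mk (fun n => if n = 0 then 0 else S n) * L := by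
    ext d
    have hr := hrec d
    have hI : Finset.Icc 1 d = (Finset.range (d + 1)).filter (· ≠ 0) := by
      ext n
      simp only [Finset.mem_Icc, Finset.mem_filter, Finset.mem_range]
      omega
    have hR : (PowerSeries.coeff d) (PowerSeries.mk (fun n => if n = 0 then 0 else S n) * L)
        = d * A d := by
      rw [hr, PowerSeries.coeff_mul, hI, Finset.sum_filter]
      simp only [PowerSeries.coeff_mk, hLq, Polynomial.coeff_coe, hcoeff]
      rw [Finset.Nat.sum_antidiagonal_eq_sum_range_succ
        (fun i j => (if i = 0 then 0 else S i) * A j)]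
      refine Finset.sum_congr rfl fun n _ => ?_
      by_cases hn : n = 0 <;> simp [hn]
    rw [hR, hLq]
    rcases d with - | d
    · simp
    · rw [PowerSeries.coeff_succ_X_mul, PowerSeries.coeff_derivative, Polynomial.coeff_coe, hcoeff]
      push_cast
      ring
  rw [powerSum_derivative s] at h1
  have h2 := mul_right_cancel₀ hL0 h1
  have hSs : ∀ n, n ≠ 0 → S n = - (s.map (· ^ n)).sum := by
    intro n hn
    have := congrArg (PowerSeries.coeff n) h2
    simp only [map_neg, PowerSeries.coeff_mk, hn, if_false] at this
    exact this.symm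
  have h3 : ∀ z ∈ s.map (· ^ 2), ‖z‖ ≤ B := by
    refine norm_le_of_powerSum_bound _ M B hB fun m hm => ?_
    have := hS m hm
    rw [hSs _ (by omega), norm_neg] at this
    simpa only [Multiset.map_map, Function.comp_def, ← pow_mul] using this
  have h4 : ∀ z ∈ s, ‖z‖ ≤ √B := by
    intro z hz
    refine Real.le_sqrt_of_sq_le ?_
    simpa using h3 _ (Multiset.mem_map_of_mem _ hz)
  rw [hSs 1 one_ne_zero, norm_neg]
  simp only [pow_one, Multiset.map_id']
  calc ‖s.sum‖ ≤ (s.map (‖·‖)).sum := norm_multiset_sum_le _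
    _ ≤ (s.map (‖·‖)).card • √B := Multiset.sum_le_card_nsmul _ _ (by
        intro x hx
        obtain ⟨z, hz, rfl⟩ := Multiset.mem_map.1 hx
        exact h4 z hz)
    _ ≤ k * √B := by
        rw [Multiset.card_map, nsmul_eq_mul]
        gcongr
        exact hs.trans hdeg

theorem sum_ne_zero_of_distinct_orders {K ι : Type*} [Field K] [Fintype ι] (β : K) (e : ι → K)
    (he : e ≠ 0) (n : ι → ℕ) (hn : Function.Injective n) (G : ι → K[X])
    (hG : ∀ i, (G i).eval β ≠ 0) : ∑ i, C (e i) * ((X - C β) ^ n i * G i) ≠ 0 := by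
  classical
  obtain ⟨i₁, hi₁⟩ := Function.ne_iff.1 he
  obtain ⟨i₀, hi₀, hmin⟩ := Finset.exists_min_image (Finset.univ.filter fun i => e i ≠ 0) n
    ⟨i₁, by simpa using hi₁⟩
  have he₀ : e i₀ ≠ 0 := by simpa using hi₀
  have hfac : ∑ i, C (e i) * ((X - C β) ^ n i * G i)
      = (X - C β) ^ n i₀ * ∑ i, C (e i) * ((X - C β) ^ (n i - n i₀) * G i) := by
    rw [Finset.mul_sum]
    refine Finset.sum_congr rfl fun i _ => ?_
    by_cases hi : e i = 0
    · simp [hi]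
    · have hle := hmin i (by simpa using hi)
      rw [← Nat.sub_add_cancel hle, pow_add, Nat.add_sub_cancel]
      ring
  rw [hfac]
  refine mul_ne_zero (pow_ne_zero _ (X_sub_C_ne_zero β)) fun h => ?_
  have h1 := congrArg (eval β) h
  rw [eval_finsetSum, Finset.sum_eq_single i₀] at h1
  · simp [he₀, hG] at h1
  · intro i _ hi
    by_cases hei : e i = 0
    · simp [hei]
    · have hlt : n i₀ < n i := lt_of_le_of_ne (hmin i (by simpa using hei)) fun h => hi (hn h).symm
      simp [show n i - n i₀ ≠ 0 by omega]
  · simp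

theorem exists_relation_of_natDegree_lt {K ι : Type*} [Field K] [Fintype ι] (v : ι → K[X])
    (N : ℕ) (hv : ∀ i, (v i).natDegree < N) (hN : N < Fintype.card ι) :
    ∃ e : ι → K, e ≠ 0 ∧ ∑ i, C (e i) * v i = 0 := by
  classical
  let Φ : (ι → K) →ₗ[K] (Fin N → K) :=
    Matrix.mulVecLin (Matrix.of fun (k : Fin N) (i : ι) => (v i).coeff k)
  have hker : LinearMap.ker Φ ≠ ⊥ := LinearMap.ker_ne_bot_of_finrank_lt (by simpa using hN)
  obtain ⟨e, he, he0⟩ := Submodule.exists_mem_ne_zero_of_ne_bot hker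
  refine ⟨e, he0, ?_⟩
  ext k
  rw [finsetSum_coeff]
  simp only [coeff_C_mul, coeff_zero]
  by_cases hk : k < N
  · have := congrFun (LinearMap.mem_ker.1 he) ⟨k, hk⟩
    simpa [Φ, Matrix.mulVec, dotProduct, mul_comm] using this
  · refine Finset.sum_eq_zero fun i _ => ?_
    rw [coeff_eq_zero_of_natDegree_lt (lt_of_lt_of_le (hv i) (not_lt.1 hk)), mul_zero]

theorem orders_injective {p M I d : ℕ} (hp : p.Prime) (hd : 0 < d) (hdp : d < p) :
    Function.Injective (fun x : (Fin I × Fin p) × Fin M =>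
      (x.2 : ℕ) + x.1.1 * (M * p) + d * (M * (p - 1 - x.1.2))) := by
  rintro ⟨⟨i, j⟩, k⟩ ⟨⟨i', j'⟩, k'⟩ h
  simp only at h
  have hM : 0 < M := k.pos
  have e : ∀ (i : Fin I) (j : Fin p) (k : Fin M), (k : ℕ) + i * (M * p) + d * (M * (p - 1 - j))
      = k + M * (i * p + d * (p - 1 - j)) := by intros; ring
  rw [e, e] at h
  have hk : (k : ℕ) = k' := by
    have := congrArg (· % M) h
    simpa [Nat.mod_eq_of_lt k.2, Nat.mod_eq_of_lt k'.2] using this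
  have h1 : (i : ℕ) * p + d * (p - 1 - j) = i' * p + d * (p - 1 - j') := by
    rw [hk] at h
    exact Nat.eq_of_mul_eq_mul_left hM (Nat.add_left_cancel h)
  have h2 : (p - 1 - j) ≡ (p - 1 - j') [MOD p] := by
    have : d * (p - 1 - j) ≡ d * (p - 1 - j') [MOD p] := by
      have := congrArg (· % p) h1
      simpa [Nat.ModEq, Nat.add_mod] using this
    refine Nat.ModEq.cancel_left_of_coprime ?_ this
    exact (Nat.Prime.coprime_iff_not_dvd hp).2 (Nat.not_dvd_of_pos_of_lt hd hdp)
  have hj : (j : ℕ) = j' := by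
    have h3 := h2.eq_of_lt_of_lt (by have := hp.pos; omega) (by have := hp.pos; omega)
    have := j.2
    have := j'.2
    omega
  have hi : (i : ℕ) = i' := by
    rw [hj] at h1
    exact Nat.eq_of_mul_eq_mul_right hp.pos (Nat.add_right_cancel h1)
  rw [Fin.ext hi, Fin.ext hj, Fin.ext hk]

theorem stepanov_bound {K : Type*} [Field K] [IsAlgClosed K] (p : ℕ) [Fact p.Prime] [CharP K p]
    (a b : K[X]) (D : ℕ) (ha : a.natDegree ≤ D) (hb : b.natDegree ≤ D)
    (hDp : D < p) (hb0 : b ≠ 0) (β : K) (hbβ : b.eval β = 0) (haβ : a.eval β ≠ 0) (c : K)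
    (m : ℕ) (hm : 1 ≤ m) (S : Finset K) (hS : ∀ α ∈ S, α ^ p ^ (2 * m) = α ∧ b.eval α ≠ 0 ∧
      ∑ i ∈ Finset.range (2 * m), (a.eval α / b.eval α) ^ p ^ i = c) :
    S.card ≤ p ^ (m - 1) * p ^ m + (2 * D + 2) * p ^ m := by
  classical
  have hp : p.Prime := Fact.out
  have : ExpChar K p := ExpChar.prime hp
  obtain ⟨m, rfl⟩ : ∃ k, m = k + 1 := ⟨m - 1, by omega⟩
  simp only [Nat.add_sub_cancel]
  set M := p ^ m with hM
  have hMpos : 0 < M := pow_pos hp.pos _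
  have hQ : p ^ (m + 1) = M * p := pow_succ _ _
  set I := M + D + 2 with hI
  have hle : ∀ i ∈ Finset.range (m + 1), p ^ i ≤ M := fun i hi =>
    Nat.pow_le_pow_right hp.pos (by simpa [Nat.lt_succ_iff] using hi)
  set W : K[X] := ∑ i ∈ Finset.range (m + 1), a ^ p ^ i * b ^ (M - p ^ i) with hW
  have hWdeg : W.natDegree ≤ M * D := by
    refine natDegree_sum_le_of_forall_le _ _ fun i hi => ?_
    have h1 := hle i hi
    calc (a ^ p ^ i * b ^ (M - p ^ i)).natDegree ≤ p ^ i * D + (M - p ^ i) * D := by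
          refine natDegree_mul_le.trans (add_le_add ?_ ?_)
          · exact natDegree_pow_le_of_le _ ha
          · exact natDegree_pow_le_of_le _ hb
      _ = M * D := by rw [← add_mul, Nat.add_sub_cancel' h1]
  have hWβ : W.eval β ≠ 0 := by
    rw [hW, eval_finsetSum, Finset.sum_range_succ, Finset.sum_eq_zero]
    · simp [← hM, haβ]
    · intro i hi
      have : p ^ i < M := Nat.pow_lt_pow_right hp.one_lt (by simpa using hi)
      simp [hbβ, show M - p ^ i ≠ 0 by omega]
  obtain ⟨b₁, hb₁, hb₁β⟩ := exists_eq_pow_rootMultiplicity_mul_and_not_dvd b hb0 β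
  set d := b.rootMultiplicity β with hd
  have hdpos : 0 < d := (rootMultiplicity_pos hb0).2 hbβ
  have hdD : d ≤ D := by
    rw [hd, ← count_roots]
    exact (Multiset.count_le_card _ _).trans ((card_roots' b).trans hb)
  rw [dvd_iff_isRoot, IsRoot.def] at hb₁β
  let ι := (Fin I × Fin p) × Fin M
  let V : K[X] := C c * b ^ M - W
  have hVdeg : V.natDegree ≤ M * D := by
    refine (natDegree_sub_le _ _).trans (max_le ?_ hWdeg)
    exact (natDegree_C_mul_le _ _).trans (natDegree_pow_le_of_le _ hb)
  let v : ι → K[X] := fun x => (X ^ (M * p) - C (β ^ (M * p))) ^ (x.2 : ℕ) *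
    (X - C (β ^ p ^ (2 * (m + 1)))) ^ (x.1.1 : ℕ) * V ^ (x.1.2 : ℕ) *
      b ^ (M * (p - 1 - x.1.2))
  have hv : ∀ x, (v x).natDegree < (M - 1) * (M * p) + I + M * D * (p - 1) := by
    intro x
    have h1 : (v x).natDegree ≤ x.2 * (M * p) + x.1.1 * 1 + x.1.2 * (M * D)
        + (M * (p - 1 - x.1.2)) * D := by
      refine natDegree_mul_le.trans (add_le_add (natDegree_mul_le.trans (add_le_add
        (natDegree_mul_le.trans (add_le_add ?_ ?_)) ?_)) ?_)
      · exact natDegree_pow_le_of_le _ (by rw [natDegree_X_pow_sub_C])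
      · exact natDegree_pow_le_of_le _ (by rw [natDegree_X_sub_C])
      · exact natDegree_pow_le_of_le _ hVdeg
      · exact natDegree_pow_le_of_le _ hb
    have h2 : x.1.2 * (M * D) + (M * (p - 1 - x.1.2)) * D = M * D * (p - 1) := by
      obtain ⟨t, ht⟩ : ∃ t, p - 1 = x.1.2 + t := ⟨p - 1 - x.1.2, by have := x.1.2.2; omega⟩
      rw [ht, Nat.add_sub_cancel_left]
      ring
    have h3 : (x.2 : ℕ) * (M * p) ≤ (M - 1) * (M * p) :=
      Nat.mul_le_mul_right _ (by have := x.2.2; omega)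
    have h4 := x.1.1.2
    omega
  obtain ⟨E, hE0, hE⟩ := exists_relation_of_natDegree_lt v _ hv (by
    simp only [ι, Fintype.card_prod, Fintype.card_fin]
    obtain ⟨M', hM'⟩ : ∃ t, M = t + 1 := ⟨M - 1, by omega⟩
    obtain ⟨p', hp'⟩ : ∃ t, p = D + 1 + t := ⟨p - (D + 1), by omega⟩
    rw [hI, hM', hp']
    simp only [Nat.add_sub_cancel]
    rw [show D + 1 + p' - 1 = D + p' by omega]
    nlinarith [Nat.zero_le (M' * D), Nat.zero_le (M' * p'), Nat.zero_le (D * p')])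
  choose e he using fun x => IsAlgClosed.exists_pow_nat_eq (E x)
    (Nat.mul_pos hMpos hp.pos)
  have he0 : e ≠ 0 := by
    rintro rfl
    refine hE0 (funext fun x => ?_)
    rw [← he x]
    simp [hMpos.ne', hp.ne_zero]
  let R : K[X] := ∑ x : ι, C (e x) * ((X - C β) ^ ((x.2 : ℕ) + x.1.1 * (M * p)) *
    (W ^ (x.1.2 : ℕ) * b ^ (M * (p - 1 - x.1.2))))
  have hR0 : R ≠ 0 := by
    have := sum_ne_zero_of_distinct_orders β e he0 _
      (orders_injective (M := M) (I := I) hp hdpos (hdD.trans_lt hDp))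
      (fun x => W ^ (x.1.2 : ℕ) * b₁ ^ (M * (p - 1 - x.1.2))) (fun x => by
        rw [eval_mul, eval_pow, eval_pow]
        exact mul_ne_zero (pow_ne_zero _ hWβ) (pow_ne_zero _ hb₁β))
    convert this using 1
    refine Finset.sum_congr rfl fun x _ => ?_
    congr 1
    conv_lhs => rw [hb₁]
    rw [mul_pow, ← pow_mul]
    ring
  have hRdeg : R.natDegree ≤ (M - 1) + (I - 1) * (M * p) + M * D * (p - 1) := by
    refine natDegree_sum_le_of_forall_le _ _ fun x _ => (natDegree_C_mul_le _ _).trans ?_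
    have h1 : ((X - C β) ^ ((x.2 : ℕ) + x.1.1 * (M * p)) *
      (W ^ (x.1.2 : ℕ) * b ^ (M * (p - 1 - x.1.2)))).natDegree ≤ ((x.2 : ℕ) + x.1.1 * (M * p)) * 1
        + (x.1.2 * (M * D) + (M * (p - 1 - x.1.2)) * D) := by
      refine natDegree_mul_le.trans (add_le_add ?_ (natDegree_mul_le.trans (add_le_add ?_ ?_)))
      · exact natDegree_pow_le_of_le _ (by rw [natDegree_X_sub_C])
      · exact natDegree_pow_le_of_le _ hWdeg
      · exact natDegree_pow_le_of_le _ hb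
    have h2 : x.1.2 * (M * D) + (M * (p - 1 - x.1.2)) * D = M * D * (p - 1) := by
      obtain ⟨t, ht⟩ : ∃ t, p - 1 = x.1.2 + t := ⟨p - 1 - x.1.2, by have := x.1.2.2; omega⟩
      rw [ht, Nat.add_sub_cancel_left]
      ring
    have h3 : (x.1.1 : ℕ) * (M * p) ≤ (I - 1) * (M * p) :=
      Nat.mul_le_mul_right _ (by have := x.1.1.2; omega)
    have h4 := x.2.2
    omega
  have hroot : ∀ α ∈ S, R.eval α = 0 := by
    intro α hα
    obtain ⟨hαq, hBα, htr⟩ := hS α hα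
    set B := b.eval α with hB
    have hWw : W.eval α = B ^ M * ∑ i ∈ Finset.range (m + 1), (a.eval α / B) ^ p ^ i := by
      rw [hW, eval_finsetSum, Finset.mul_sum]
      refine Finset.sum_congr rfl fun i hi => ?_
      rw [eval_mul, eval_pow, eval_pow, ← hB, div_pow, ← Nat.sub_add_cancel (hle i hi), pow_add,
        Nat.add_sub_cancel]
      field_simp
    set w := ∑ i ∈ Finset.range (m + 1), (a.eval α / B) ^ p ^ i with hw
    have hwc : w ^ (M * p) = c - w := by
      rw [← htr, two_mul, Finset.sum_range_add, ← hw, add_sub_cancel_left, ← hQ, hw,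
        sum_pow_char_pow]
      refine Finset.sum_congr rfl fun i _ => ?_
      rw [← pow_mul, ← pow_add, add_comm]
    have hterm : ∀ x : ι, (C (e x) * ((X - C β) ^ ((x.2 : ℕ) + x.1.1 * (M * p)) *
        (W ^ (x.1.2 : ℕ) * b ^ (M * (p - 1 - x.1.2))))).eval α ^ (M * p) * B ^ (M * (p - 1))
        = B ^ (M * (p - 1) * (M * p)) * (C (E x) * v x).eval α := by
      intro x
      obtain ⟨t, ht⟩ : ∃ t, p - 1 = x.1.2 + t := ⟨p - 1 - x.1.2, by have := x.1.2.2; omega⟩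
      have hq2 : p ^ (2 * (m + 1)) = (M * p) * (M * p) := by rw [← hQ]; ring
      have s1 : (α - β) ^ (M * p) = α ^ (M * p) - β ^ (M * p) := by
        rw [← hQ, sub_pow_char_pow]
      have s2 : (α - β) ^ (M * p * (M * p)) = α - β ^ p ^ (2 * (m + 1)) := by
        rw [← hq2, sub_pow_char_pow, hαq]
      simp only [v, V, eval_mul, eval_pow, eval_sub, eval_C, eval_X, ← hB, hWw, ht,
        Nat.add_sub_cancel_left, mul_pow, he, ← s1, ← s2, ← pow_mul]
      have s3 : B ^ M * (c - w) = c * B ^ M - B ^ M * w := by ring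
      rw [← s3, ← hwc]
      ring
    have hpow : R.eval α ^ (M * p) * B ^ (M * (p - 1)) = 0 := by
      rw [eval_finsetSum, ← hQ, sum_pow_char_pow, hQ, Finset.sum_mul]
      rw [Finset.sum_congr rfl fun x _ => hterm x, ← Finset.mul_sum, ← eval_finsetSum, hE,
        eval_zero, mul_zero]
    have := (mul_eq_zero.1 hpow).resolve_right (pow_ne_zero _ hBα)
    exact pow_eq_zero_iff (Nat.mul_pos hMpos hp.pos).ne' |>.1 this
  have hcard : S.card ≤ R.natDegree :=
    card_le_degree_of_subset_roots (fun α hα => (mem_roots hR0).2 (hroot α hα))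
  refine hcard.trans (hRdeg.trans ?_)
  rw [hQ, hI]
  have h5 : M * D * (p - 1) ≤ D * (M * p) := by
    calc M * D * (p - 1) ≤ M * D * p := Nat.mul_le_mul_left _ (Nat.sub_le _ _)
      _ = D * (M * p) := by ring
  have h6 : M - 1 ≤ M * p := (Nat.sub_le _ _).trans (Nat.le_mul_of_pos_right _ hp.pos)
  have h7 : (M + D + 2 - 1) = M + D + 1 := rfl
  rw [h7]
  nlinarith

theorem exists_matrix_charpoly_eq {R : Type*} [CommRing R] [Nontrivial R] (h : R[X])
    (hm : h.Monic) : ∃ (n : ℕ) (M : Matrix (Fin n) (Fin n) R), M.charpoly = h := by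
  let B := (AdjoinRoot.powerBasis' hm).basis
  refine ⟨_, Algebra.leftMulMatrix B (AdjoinRoot.root h), ?_⟩
  have h1 := Matrix.aeval_self_charpoly (Algebra.leftMulMatrix B (AdjoinRoot.root h))
  rw [aeval_algHom_apply] at h1
  have h2 := (injective_iff_map_eq_zero _).1 (Algebra.leftMulMatrix_injective B) _ h1
  rw [AdjoinRoot.aeval_eq, AdjoinRoot.mk_eq_zero] at h2
  refine (eq_of_monic_of_dvd_of_natDegree_le hm (Matrix.charpoly_monic _) h2 ?_)
  rw [Matrix.charpoly_natDegree_eq_dim, Fintype.card_fin]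
  simp

theorem dualNumber_multiset_prod_fst {L : Type*} [Field L] (s : Multiset (DualNumber L)) :
    s.prod.fst = (s.map TrivSqZeroExt.fst).prod := by
  induction s using Multiset.induction_on with
  | empty => simp
  | cons x s ih => simp [ih]

theorem dualNumber_multiset_prod_log {L : Type*} [Field L] (s : Multiset (DualNumber L))
    (hs : ∀ x ∈ s, x.fst ≠ 0) :
    s.prod.snd / s.prod.fst = (s.map fun x => x.snd / x.fst).sum := by
  induction s using Multiset.induction_on with
  | empty => simp
  | cons x s ih =>
    have hx : x.fst ≠ 0 := hs x (by simp)
    have h2 : ∀ y ∈ s, y.fst ≠ 0 := fun y hy => hs y (by simp [hy])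
    have hp : s.prod.fst ≠ 0 := by
      rw [dualNumber_multiset_prod_fst]
      refine Multiset.prod_ne_zero fun h => ?_
      obtain ⟨y, hy, h0⟩ := Multiset.mem_map.1 h
      exact h2 y hy h0
    rw [Multiset.prod_cons, Multiset.map_cons, Multiset.sum_cons, ← ih h2, DualNumber.snd_mul,
      TrivSqZeroExt.fst_mul]
    field_simp
    ring

open scoped DualNumber in
theorem exists_dualNumber_baseChange (F L : Type*) [Field F] [Field L] [Algebra F L] :
    ∃ φ : F[ε] →ₐ[F] L[ε], φ ε = ε ∧ ∀ x, (φ x).fst = algebraMap F L x.fst ∧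
      (φ x).snd = algebraMap F L x.snd := by
  refine ⟨DualNumber.lift ⟨(Algebra.ofId F L[ε], ε), by simp, fun a => Commute.all _ _⟩,
    by simp, fun x => ?_⟩
  rw [DualNumber.lift_apply_apply]
  have : ∀ c : F, Algebra.ofId F L[ε] c = TrivSqZeroExt.inl (algebraMap F L c) := fun c => rfl
  simp [this]

open scoped DualNumber in
theorem exists_residue_character {F L : Type} [Field F] [Field L] [Algebra F L] (a b : F[X])
    (hb : b.Monic) (hab : a.degree < b.degree) (ψ : AddChar F ℂ) :
    ∃ χ : F[X] →* ℂ, (∀ g h, b ^ 2 ∣ g - h → χ g = χ h) ∧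
      ∀ (s : Multiset L) (G : F[X]), G.map (algebraMap F L) = (s.map fun θ => X - C θ).prod →
        ((∃ θ ∈ s, aeval θ b = 0) → χ G = 0) ∧
        ((∀ θ ∈ s, aeval θ b ≠ 0) → ∀ c : F,
          (s.map fun θ => aeval θ a / aeval θ b).sum = algebraMap F L c → χ G = ψ c) := by
  classical
  set h : F[ε][X] := b.map (algebraMap F F[ε]) + C ε * a.map (algebraMap F F[ε]) with hh
  have hm : h.Monic := by
    refine (hb.map _).add_of_left ?_
    rw [hb.degree_map]
    refine lt_of_le_of_lt ?_ hab
    exact (degree_mul_le _ _).trans ((add_le_add degree_C_le degree_map_le).trans (zero_add _).le)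
  obtain ⟨n, M, hM⟩ := exists_matrix_charpoly_eq h hm
  obtain ⟨φ, hφε, hφ⟩ := exists_dualNumber_baseChange F L
  let N : F[X] →* F[ε] :=
    (Matrix.detMonoidHom).comp ((aeval M : F[X] →ₐ[F] _) : F[X] →* Matrix (Fin n) (Fin n) F[ε])
  have hNdef : ∀ g, N g = (aeval M g).det := fun g => rfl
  have hb2 : aeval M (b ^ 2) = 0 := by
    have h1 := Matrix.aeval_self_charpoly M
    rw [hM, hh, map_add, map_mul, aeval_map_algebraMap, aeval_map_algebraMap, aeval_C,
      ← Algebra.smul_def] at h1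
    rw [map_pow, eq_neg_of_add_eq_zero_left h1, neg_sq, _root_.smul_pow, sq, DualNumber.eps_mul_eps,
      zero_smul]
  have hNcongr : ∀ g h, b ^ 2 ∣ g - h → N g = N h := by
    rintro g h ⟨r, hr⟩
    rw [hNdef, hNdef, sub_eq_iff_eq_add.1 hr, map_add, map_mul, hb2, zero_mul, zero_add]
  have hNG : ∀ (s : Multiset L) (G : F[X]),
      G.map (algebraMap F L) = (s.map fun θ => X - C θ).prod →
      φ (N G) = (s.map fun θ => (-1) ^ n * (TrivSqZeroExt.inl (aeval θ b) +
        ε * TrivSqZeroExt.inl (aeval θ a) : L[ε])).prod := by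
    intro s G hG
    have e1 : φ (N G) = (aeval (M.map φ) (G.map (algebraMap F L))).det := by
      rw [hNdef, aeval_map_algebraMap, AlgHom.map_det]
      congr 1
      exact (aeval_algHom_apply φ.mapMatrix M G).symm
    let N' : L[X] →* L[ε] := (Matrix.detMonoidHom).comp
      ((aeval (M.map φ) : L[X] →ₐ[L] _) : L[X] →* Matrix (Fin n) (Fin n) L[ε])
    have e0 : ∀ g, N' g = (aeval (M.map φ) g).det := fun g => rfl
    rw [e1, hG, ← e0, map_multiset_prod, Multiset.map_map]
    congr 1
    refine Multiset.map_congr rfl fun θ _ => ?_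
    have e2 : aeval (M.map φ) (X - C θ : L[X])
        = - (Matrix.scalar _ (TrivSqZeroExt.inl θ : L[ε]) - M.map φ) := by
      rw [map_sub, aeval_X, aeval_C, neg_sub]
      rfl
    rw [Function.comp_apply, e0, e2, Matrix.det_neg, ← Matrix.eval_charpoly, Fintype.card_fin]
    congr 1
    have e3 : (M.map φ).charpoly = h.map (φ : F[ε] →+* L[ε]) := by
      rw [← hM, ← Matrix.charpoly_map]
      rfl
    rw [e3, hh, Polynomial.map_add, Polynomial.map_mul, map_C, eval_add, eval_mul, eval_C]
    have e4 : ∀ g : F[X], eval (TrivSqZeroExt.inl θ : L[ε])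
        ((g.map (algebraMap F F[ε])).map (φ : F[ε] →+* L[ε])) = TrivSqZeroExt.inl (aeval θ g) := by
      intro g
      rw [map_map, eval_map, AlgHom.comp_algebraMap, ← aeval_def]
      exact aeval_algHom_apply (TrivSqZeroExt.inlAlgHom F L L) θ g
    rw [e4, e4]
    congr 2
  let χ : F[X] →* ℂ :=
    { toFun := fun g => if (N g).fst = 0 then 0 else ψ ((N g).snd / (N g).fst)
      map_one' := by simp
      map_mul' := by
        intro g h
        by_cases hg : (N g).fst = 0
        · simp [hg]
        by_cases hh : (N h).fst = 0
        · simp [hh]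
        have e : (N (g * h)).snd / (N (g * h)).fst
            = (N g).snd / (N g).fst + (N h).snd / (N h).fst := by
          rw [map_mul, DualNumber.snd_mul, TrivSqZeroExt.fst_mul]
          field_simp
          ring
        rw [e, AddChar.map_add_eq_mul]
        simp [hg, hh] }
  have hχ : ∀ g, χ g = if (N g).fst = 0 then 0 else ψ ((N g).snd / (N g).fst) := fun g => rfl
  refine ⟨χ, fun g h hgh => by rw [hχ, hχ, hNcongr g h hgh], fun s G hG => ?_⟩
  have hfst : algebraMap F L (N G).fst = (s.map fun θ => (-1) ^ n * aeval θ b).prod := by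
    rw [← (hφ _).1, hNG s G hG, dualNumber_multiset_prod_fst, Multiset.map_map]
    congr 1
    refine Multiset.map_congr rfl fun θ _ => ?_
    have : ((-1 : L[ε]) ^ n).fst = (-1) ^ n := by simp [TrivSqZeroExt.fst_pow]
    simp [this]
  constructor
  · rintro ⟨θ, hθ, hbθ⟩
    have : (N G).fst = 0 := by
      apply (algebraMap F L).injective
      rw [hfst, map_zero]
      exact Multiset.prod_eq_zero (Multiset.mem_map.2 ⟨θ, hθ, by simp [hbθ]⟩)
    rw [hχ, if_pos this]
  · intro hs c hc
    have hne : (N G).fst ≠ 0 := by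
      intro h0
      rw [h0, map_zero] at hfst
      obtain ⟨θ, hθ, h0⟩ := Multiset.mem_map.1 (Multiset.prod_eq_zero_iff.1 hfst.symm)
      simp [hs θ hθ] at h0
    rw [hχ, if_neg hne]
    congr 1
    apply (algebraMap F L).injective
    have e5 : ∀ θ, ((-1 : L[ε]) ^ n * (TrivSqZeroExt.inl (aeval θ b) +
        ε * TrivSqZeroExt.inl (aeval θ a))).fst = (-1) ^ n * aeval θ b := by
      intro θ
      have : ((-1 : L[ε]) ^ n).fst = (-1) ^ n := by simp [TrivSqZeroExt.fst_pow]
      simp [this]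
    have e6 : ∀ θ, ((-1 : L[ε]) ^ n * (TrivSqZeroExt.inl (aeval θ b) +
        ε * TrivSqZeroExt.inl (aeval θ a))).snd = (-1) ^ n * aeval θ a := by
      intro θ
      have : (-1 : L[ε]) ^ n = TrivSqZeroExt.inl ((-1) ^ n) := by
        rw [← TrivSqZeroExt.inl_pow, TrivSqZeroExt.inl_neg, TrivSqZeroExt.inl_one]
      rw [this]
      simp
    rw [map_div₀, ← (hφ _).1, ← (hφ _).2, ← hc, hNG s G hG, dualNumber_multiset_prod_log,
      Multiset.map_map]
    · congr 1
      refine Multiset.map_congr rfl fun θ _ => ?_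
      simp only [Function.comp, e5, e6]
      rw [mul_div_mul_left _ _ (pow_ne_zero _ (by simp))]
    · intro x hx
      obtain ⟨θ, hθ, rfl⟩ := Multiset.mem_map.1 hx
      rw [e5]
      exact mul_ne_zero (pow_ne_zero _ (by simp)) (hs θ hθ)

theorem finite_monic_natDegree_eq (F : Type*) [Field F] [Finite F] (d : ℕ) :
    {g : F[X] | g.Monic ∧ g.natDegree = d}.Finite := by
  refine Set.Finite.of_injOn (f := fun g (i : Fin (d + 1)) => g.coeff i)
    (t := Set.univ) (fun _ _ => Set.mem_univ _) ?_ Set.finite_univ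
  rintro g ⟨-, hg⟩ h ⟨-, hh⟩ hgh
  ext i
  by_cases hi : i < d + 1
  · exact congrFun hgh ⟨i, hi⟩
  · rw [coeff_eq_zero_of_natDegree_lt (by omega), coeff_eq_zero_of_natDegree_lt (by omega)]

/-- The finite set of monic polynomials of degree `d` over a finite field. -/
noncomputable def monicsOfDegree (F : Type*) [Field F] [Finite F] (d : ℕ) : Finset F[X] :=
  (finite_monic_natDegree_eq F d).toFinset

theorem mem_monicsOfDegree {F : Type*} [Field F] [Finite F] {d : ℕ} {g : F[X]} :
    g ∈ monicsOfDegree F d ↔ g.Monic ∧ g.natDegree = d := by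
  simp [monicsOfDegree]

theorem sum_monicsOfDegree_zero {F : Type*} [Field F] [Finite F] (χ : F[X] →* ℂ) :
    ∑ g ∈ monicsOfDegree F 0, χ g = 1 := by
  have : monicsOfDegree F 0 = {1} := by
    ext g
    rw [mem_monicsOfDegree, Finset.mem_singleton]
    constructor
    · rintro ⟨h1, h2⟩
      exact h1.natDegree_eq_zero.1 h2
    · rintro rfl
      simp
  rw [this, Finset.sum_singleton, map_one]

theorem sum_monicsOfDegree_eq_zero {F : Type*} [Field F] [Finite F] (χ : F[X] →* ℂ) (m : F[X])
    (hm : m.Monic) (hχ : ∀ g h, m ∣ g - h → χ g = χ h) (h : F[X]) (hcop : IsCoprime m h)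
    (h1 : χ h ≠ 1) (d : ℕ) (hd : m.natDegree ≤ d) : ∑ g ∈ monicsOfDegree F d, χ g = 0 := by
  classical
  by_cases hm1 : m = 1
  · exact absurd ((hχ h 1 (by simp [hm1])).trans (map_one χ)) h1
  let φ : F[X] → F[X] := fun g => g + ((h * g) %ₘ m - g %ₘ m)
  have hdeg : ∀ g, ((h * g) %ₘ m - g %ₘ m).natDegree < m.natDegree := fun g =>
    lt_of_le_of_lt (natDegree_sub_le _ _)
      (max_lt (natDegree_modByMonic_lt _ hm hm1) (natDegree_modByMonic_lt _ hm hm1))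
  have hmaps : ∀ g ∈ monicsOfDegree F d, φ g ∈ monicsOfDegree F d := by
    intro g hg
    rw [mem_monicsOfDegree] at hg ⊢
    have hlt : ((h * g) %ₘ m - g %ₘ m).natDegree < g.natDegree := by
      have := hdeg g
      omega
    exact ⟨hg.1.add_of_left (degree_lt_degree hlt),
      (natDegree_add_eq_left_of_natDegree_lt hlt).trans hg.2⟩
  have hmod : ∀ g, m ∣ g - g %ₘ m := fun g => ⟨g /ₘ m, by
    rw [sub_eq_iff_eq_add', modByMonic_add_div]⟩
  have hφ : ∀ g, m ∣ φ g - h * g := by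
    intro g
    have : φ g - h * g = (g - g %ₘ m) - (h * g - (h * g) %ₘ m) := by
      simp only [φ]
      ring
    rw [this]
    exact dvd_sub (hmod _) (hmod _)
  have hinj : Set.InjOn φ (monicsOfDegree F d) := by
    intro g _ g' _ hgg
    have e1 : m ∣ h * (g - g') := by
      have := dvd_sub (hφ g') (hφ g)
      rw [hgg] at this
      convert this using 1
      ring
    have e2 : m ∣ g - g' := hcop.dvd_of_dvd_mul_left e1
    have e3 : g %ₘ m = g' %ₘ m := (modByMonic_eq_of_dvd_sub hm e2)
    have e4 : (h * g) %ₘ m = (h * g') %ₘ m := modByMonic_eq_of_dvd_sub hm (by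
      rwa [← mul_sub])
    simp only [φ, e3, e4] at hgg
    simpa using hgg
  have key : ∑ g ∈ monicsOfDegree F d, χ h * χ g = ∑ g ∈ monicsOfDegree F d, χ g := by
    refine Finset.sum_nbij φ hmaps hinj
      (Finset.surjOn_of_injOn_of_card_le φ hmaps hinj le_rfl) fun g _ => ?_
    rw [hχ _ _ (hφ g), map_mul]
  rw [← Finset.mul_sum] at key
  have : (χ h - 1) * ∑ g ∈ monicsOfDegree F d, χ g = 0 := by
    rw [sub_mul, key, one_mul, sub_self]
  exact (mul_eq_zero.1 this).resolve_left (sub_ne_zero.2 h1)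

theorem sum_monicsOfDegree_dvd {F : Type*} [Field F] [Finite F] (χ : F[X] →* ℂ) (G : F[X])
    (hG : G.Monic) (d : ℕ) (hd : G.natDegree ≤ d) [DecidablePred fun g => G ∣ g] :
    ∑ g ∈ (monicsOfDegree F d).filter (fun g => G ∣ g), χ g =
      χ G * ∑ g ∈ monicsOfDegree F (d - G.natDegree), χ g := by
  rw [Finset.mul_sum]
  symm
  refine Finset.sum_nbij (fun g => G * g) ?_ ?_ ?_ fun g _ => (map_mul χ G g).symm
  · intro g hg
    rw [mem_monicsOfDegree] at hg
    rw [Finset.mem_filter, mem_monicsOfDegree, hG.natDegree_mul hg.1]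
    exact ⟨⟨hG.mul hg.1, by omega⟩, dvd_mul_right _ _⟩
  · intro g _ g' _ h
    exact mul_left_cancel₀ hG.ne_zero h
  · intro g hg
    rw [Finset.mem_coe, Finset.mem_filter, mem_monicsOfDegree] at hg
    obtain ⟨⟨h1, h2⟩, r, rfl⟩ := hg
    have hr : r.Monic := hG.of_mul_monic_left h1
    rw [hG.natDegree_mul hr] at h2
    exact ⟨r, by rw [Finset.mem_coe, mem_monicsOfDegree]; exact ⟨hr, by omega⟩, rfl⟩

theorem prod_range_mul_of_periodic {M : Type*} [CommMonoid M] (u : ℕ → M) (e : ℕ)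
    (hu : ∀ i, u (i + e) = u i) (j : ℕ) :
    ∏ i ∈ Finset.range (e * j), u i = (∏ i ∈ Finset.range e, u i) ^ j := by
  induction j with
  | zero => simp
  | succ j ih =>
    have hu' : ∀ k i, u (e * k + i) = u i := by
      intro k
      induction k with
      | zero => simp
      | succ k ihk =>
        intro i
        rw [← ihk i, ← hu (e * k + i)]
        congr 1
        ring
    rw [Nat.mul_succ, Finset.prod_range_add, ih, pow_succ]
    congr 1
    exact Finset.prod_congr rfl fun i _ => hu' j i

theorem card_periods_eq_rootMultiplicity {L : Type*} [Field L] (f : L →+* L) (g : L[X]) (hg : g.Monic) (hinv : g.map f = g) (x : L)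
    (hx : g.IsRoot x)
    [DecidablePred fun n => Function.IsPeriodicPt f n x ∧
      ∏ i ∈ Finset.range n, (X - C (f^[i] x)) ∣ g] :
    ((Finset.Icc 1 g.natDegree).filter fun n => Function.IsPeriodicPt f n x ∧
      ∏ i ∈ Finset.range n, (X - C (f^[i] x)) ∣ g).card = g.rootMultiplicity x := by
  classical
  set e := Function.minimalPeriod f x with he
  have hg0 := hg.ne_zero
  have hdvd : ∀ i, (X - C (f^[i] x)) ^ g.rootMultiplicity x ∣ g := by
    intro i
    induction i with
    | zero => exact pow_rootMultiplicity_dvd g x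
    | succ i ih =>
      have := Polynomial.map_dvd f ih
      rwa [hinv, Polynomial.map_pow, Polynomial.map_sub, map_X, map_C,
        ← Function.iterate_succ_apply' f] at this
  have hmult : 0 < g.rootMultiplicity x := (rootMultiplicity_pos hg0).2 hx
  have hroot : ∀ i, f^[i] x ∈ (g.roots.toFinset : Set L) := by
    intro i
    rw [Finset.mem_coe, Multiset.mem_toFinset, mem_roots hg0, ← dvd_iff_isRoot]
    exact (dvd_pow_self _ hmult.ne').trans (hdvd i)
  have hfinj : Function.Injective f := f.injective
  have hepos : 0 < e := by
    rw [he, Function.minimalPeriod_pos_iff_mem_periodicPts]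
    obtain ⟨i, j, hij, h⟩ :=
      (Finset.finite_toSet g.roots.toFinset).exists_lt_map_eq_of_forall_mem hroot
    refine ⟨j - i, by omega, ?_⟩
    apply hfinj.iterate i
    rw [← Function.iterate_add_apply, h]
    congr 2
    omega
  have hper : ∀ j, ∏ i ∈ Finset.range (e * j), (X - C (f^[i] x)) =
      (∏ i ∈ Finset.range e, (X - C (f^[i] x))) ^ j := by
    refine prod_range_mul_of_periodic _ e fun i => ?_
    rw [he, Function.iterate_add_minimalPeriod_eq]
  have hiff : ∀ j, ∏ i ∈ Finset.range (e * j), (X - C (f^[i] x)) ∣ g ↔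
      j ≤ g.rootMultiplicity x := by
    intro j
    rw [hper]
    constructor
    · intro h
      rw [le_rootMultiplicity_iff hg0]
      refine (pow_dvd_pow_of_dvd ?_ j).trans h
      simpa using Finset.dvd_prod_of_mem (fun i => X - C (f^[i] x)) (Finset.mem_range.2 hepos)
    · intro h
      rw [← Finset.prod_pow]
      refine Finset.prod_dvd_of_coprime ?_ fun i _ => (pow_dvd_pow _ h).trans (hdvd i)
      intro i hi k hk hik
      refine IsCoprime.pow (isCoprime_X_sub_C_of_isUnit_sub ?_)
      rw [isUnit_iff_ne_zero, sub_ne_zero]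
      intro h'
      exact hik (Function.iterate_injOn_Iio_minimalPeriod (by simpa using hi) (by simpa using hk) h')
  have himg : ((Finset.Icc 1 g.natDegree).filter fun n => Function.IsPeriodicPt f n x ∧
      ∏ i ∈ Finset.range n, (X - C (f^[i] x)) ∣ g) =
      (Finset.Icc 1 (g.rootMultiplicity x)).image fun j => e * j := by
    ext n
    simp only [Finset.mem_filter, Finset.mem_image, Finset.mem_Icc]
    constructor
    · rintro ⟨⟨h1, _⟩, h2, h3⟩
      obtain ⟨j, rfl⟩ := h2.minimalPeriod_dvd
      refine ⟨j, ⟨Nat.pos_of_ne_zero ?_, (hiff j).1 h3⟩, rfl⟩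
      rintro rfl
      simp at h1
    · rintro ⟨j, ⟨h1, h2⟩, rfl⟩
      have h3 := (hiff j).2 h2
      refine ⟨⟨Nat.mul_pos hepos h1, ?_⟩, ?_, h3⟩
      · have := natDegree_le_of_dvd h3 hg0
        rwa [natDegree_finsetProd_X_sub_C_eq_card, Finset.card_range] at this
      · exact (Function.isPeriodicPt_minimalPeriod f x).mul_const j
  rw [himg, Finset.card_image_of_injective, Nat.card_Icc, Nat.add_sub_cancel]
  exact fun i j h => Nat.eq_of_mul_eq_mul_left hepos h

theorem sum_card_periods {L : Type*} [Field L] [IsAlgClosed L] (f : L →+* L) (g : L[X]) (hg : g.Monic) (hinv : g.map f = g)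
    (fix : ℕ → Finset L)
    (hfix : ∀ n, 1 ≤ n → ∀ x, x ∈ fix n ↔ Function.IsPeriodicPt f n x)
    [∀ n, DecidablePred fun x => ∏ i ∈ Finset.range n, (X - C (f^[i] x)) ∣ g] :
    ∑ n ∈ Finset.Icc 1 g.natDegree, ((fix n).filter fun x =>
      ∏ i ∈ Finset.range n, (X - C (f^[i] x)) ∣ g).card = g.natDegree := by
  classical
  have h1 : ∀ n ∈ Finset.Icc 1 g.natDegree, ((fix n).filter fun x =>
      ∏ i ∈ Finset.range n, (X - C (f^[i] x)) ∣ g) =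
      g.roots.toFinset.filter fun x => Function.IsPeriodicPt f n x ∧
        ∏ i ∈ Finset.range n, (X - C (f^[i] x)) ∣ g := by
    intro n hn
    have hn1 := (Finset.mem_Icc.1 hn).1
    ext x
    rw [Finset.mem_filter, Finset.mem_filter, hfix n hn1, Multiset.mem_toFinset,
      mem_roots hg.ne_zero]
    refine ⟨fun h => ⟨?_, h⟩, fun h => h.2⟩
    rw [← dvd_iff_isRoot]
    refine dvd_trans ?_ h.2
    simpa using Finset.dvd_prod_of_mem (fun i => X - C (f^[i] x))
      (Finset.mem_range.2 hn1)
  calc _ = ∑ n ∈ Finset.Icc 1 g.natDegree, (g.roots.toFinset.filter fun x =>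
          Function.IsPeriodicPt f n x ∧
          ∏ i ∈ Finset.range n, (X - C (f^[i] x)) ∣ g).card :=
        Finset.sum_congr rfl fun n hn => by rw [h1 n hn]
    _ = ∑ x ∈ g.roots.toFinset, ((Finset.Icc 1 g.natDegree).filter fun n =>
          Function.IsPeriodicPt f n x ∧
          ∏ i ∈ Finset.range n, (X - C (f^[i] x)) ∣ g).card := by
        simp_rw [Finset.card_filter]
        exact Finset.sum_comm
    _ = ∑ x ∈ g.roots.toFinset, g.roots.count x := by
        refine Finset.sum_congr rfl fun x hx => ?_
        rw [Multiset.mem_toFinset, mem_roots hg.ne_zero] at hx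
        rw [card_periods_eq_rootMultiplicity f g hg hinv x hx, count_roots]
    _ = g.natDegree := by
        rw [Multiset.toFinset_sum_count_eq]
        exact (splits_iff_card_roots.1 (IsAlgClosed.splits g))

theorem mem_range_algebraMap_zmod_of_frobenius {L : Type*} [Field L] (p : ℕ) [Fact p.Prime]
    [CharP L p] [Algebra (ZMod p) L] (x : L) (hx : frobenius L p x = x) :
    x ∈ Set.range (algebraMap (ZMod p) L) := by
  have h := (Subfield.mem_bot_iff_pow_eq_self L p).2 hx
  rw [← ZMod.fieldRange_castHom_eq_bot p] at h
  obtain ⟨z, hz⟩ := h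
  exact ⟨z, by rw [← hz]; congr 1; exact Subsingleton.elim _ _⟩

theorem algebraMap_zmod_frobenius {L : Type*} [Field L] (p : ℕ) [Fact p.Prime]
    [CharP L p] [Algebra (ZMod p) L] (g : (ZMod p)[X]) :
    (g.map (algebraMap (ZMod p) L)).map (frobenius L p) = g.map (algebraMap (ZMod p) L) := by
  rw [map_map]
  congr 1
  exact Subsingleton.elim _ _

theorem exists_map_eq_prod_iterates {L : Type*} [Field L] (p : ℕ) [Fact p.Prime]
    [CharP L p] [Algebra (ZMod p) L] (n : ℕ) (x : L)
    (hx : Function.IsPeriodicPt (frobenius L p) n x) :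
    ∃ G : (ZMod p)[X], G.map (algebraMap (ZMod p) L) =
      ∏ i ∈ Finset.range n, (X - C ((frobenius L p)^[i] x)) := by
  rw [← mem_lifts, lifts_iff_coeff_lifts]
  intro k
  apply mem_range_algebraMap_zmod_of_frobenius p
  rw [← coeff_map]
  congr 1
  rw [Polynomial.map_prod]
  simp only [Polynomial.map_sub, map_X, map_C, ← Function.iterate_succ_apply' (frobenius L p)]
  have h := (Finset.prod_range_succ (fun i => X - C ((frobenius L p)^[i] x)) n).symm.trans
    (Finset.prod_range_succ' (fun i => X - C ((frobenius L p)^[i] x)) n)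
  rw [hx.eq] at h
  exact (mul_right_cancel₀ (X_sub_C_ne_zero x) h).symm

theorem natDegree_mul_sum_monicsOfDegree {L : Type*} [Field L] [IsAlgClosed L] (p : ℕ)
    [Fact p.Prime] [CharP L p] [Algebra (ZMod p) L] (χ : (ZMod p)[X] →* ℂ) (fix : ℕ → Finset L)
    (hfix : ∀ n, 1 ≤ n → ∀ x, x ∈ fix n ↔ Function.IsPeriodicPt (frobenius L p) n x)
    (G : ℕ → L → (ZMod p)[X]) (hG : ∀ n, 1 ≤ n → ∀ x ∈ fix n, (G n x).map (algebraMap (ZMod p) L) =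
      ∏ i ∈ Finset.range n, (X - C ((frobenius L p)^[i] x))) (d : ℕ) :
    (d : ℂ) * ∑ g ∈ monicsOfDegree (ZMod p) d, χ g = ∑ n ∈ Finset.Icc 1 d,
      (∑ x ∈ fix n, χ (G n x)) * ∑ g ∈ monicsOfDegree (ZMod p) (d - n), χ g := by
  classical
  have hinj := (algebraMap (ZMod p) L).injective
  have hGm : ∀ n, 1 ≤ n → ∀ x ∈ fix n, (G n x).Monic ∧ (G n x).natDegree = n := by
    intro n hn x hx
    rw [← natDegree_map (algebraMap (ZMod p) L), hG n hn x hx,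
      natDegree_finsetProd_X_sub_C_eq_card, Finset.card_range]
    refine ⟨monic_of_injective hinj ?_, rfl⟩
    rw [hG n hn x hx]
    exact monic_prod_of_monic _ _ fun i _ => monic_X_sub_C _
  calc (d : ℂ) * ∑ g ∈ monicsOfDegree (ZMod p) d, χ g
      = ∑ g ∈ monicsOfDegree (ZMod p) d, ∑ n ∈ Finset.Icc 1 d,
          ∑ x ∈ fix n, if G n x ∣ g then χ g else 0 := by
        rw [Finset.mul_sum]
        refine Finset.sum_congr rfl fun g hg => ?_
        rw [mem_monicsOfDegree] at hg
        have h := sum_card_periods (frobenius L p) (g.map (algebraMap (ZMod p) L)) (hg.1.map _)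
          (algebraMap_zmod_frobenius p g) fix hfix
        rw [natDegree_map, hg.2] at h
        nth_rewrite 1 [← h]
        rw [Nat.cast_sum, Finset.sum_mul]
        refine Finset.sum_congr rfl fun n hn => ?_
        rw [← Finset.sum_filter, Finset.sum_const, nsmul_eq_mul]
        congr 3
        refine Finset.filter_congr fun x hx => ?_
        rw [← hG n (Finset.mem_Icc.1 hn).1 x hx, map_dvd_map' (algebraMap (ZMod p) L)]
    _ = ∑ n ∈ Finset.Icc 1 d, ∑ x ∈ fix n, ∑ g ∈ monicsOfDegree (ZMod p) d,
          if G n x ∣ g then χ g else 0 := by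
        rw [Finset.sum_comm]
        exact Finset.sum_congr rfl fun n _ => Finset.sum_comm
    _ = _ := by
        refine Finset.sum_congr rfl fun n hn => ?_
        rw [Finset.sum_mul]
        refine Finset.sum_congr rfl fun x hx => ?_
        obtain ⟨hn1, hn2⟩ := Finset.mem_Icc.1 hn
        obtain ⟨hm, hd⟩ := hGm n hn1 x hx
        rw [← Finset.sum_filter, sum_monicsOfDegree_dvd χ _ hm d (by omega), hd]

theorem exists_finset_frobenius_periodic {L : Type*} [Field L] [IsAlgClosed L] (p : ℕ)
    [Fact p.Prime] [CharP L p] (n : ℕ) (hn : 1 ≤ n) :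
    ∃ s : Finset L, (∀ x, x ∈ s ↔ Function.IsPeriodicPt (frobenius L p) n x) ∧
      s.card = p ^ n := by
  classical
  have hp : 1 < p := (Fact.out : p.Prime).one_lt
  have h0 : (X ^ p ^ n - X : L[X]) ≠ 0 :=
    FiniteField.X_pow_card_pow_sub_X_ne_zero L (by omega) hp
  refine ⟨(X ^ p ^ n - X : L[X]).roots.toFinset, fun x => ?_, ?_⟩
  · rw [Multiset.mem_toFinset, mem_roots h0, Function.IsPeriodicPt, Function.IsFixedPt,
      iterate_frobenius]
    simp [sub_eq_zero]
  · rw [Multiset.toFinset_card_of_nodup (nodup_roots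
      (galois_poly_separable p _ (dvd_pow_self p (by omega)))),
      splits_iff_card_roots.1 (IsAlgClosed.splits _),
      FiniteField.X_pow_card_pow_sub_X_natDegree_eq L (by omega) hp]

theorem norm_sum_addChar_le_of_fiber_card_le {p : ℕ} [Fact p.Prime] {ι : Type*} (s : Finset ι)
    (t : ι → ZMod p) (ψ : AddChar (ZMod p) ℂ) (hψ : ψ ≠ 1) (B : ℝ)
    (hB : ∀ c, ((s.filter fun x => t x = c).card : ℝ) ≤ B) :
    ‖∑ x ∈ s, ψ (t x)‖ ≤ p * B - s.card := by
  have h1 : ∑ x ∈ s, ψ (t x) = ∑ c, ((s.filter fun x => t x = c).card : ℂ) * ψ c := by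
    rw [← Finset.sum_fiberwise s t]
    refine Finset.sum_congr rfl fun c _ => ?_
    rw [Finset.sum_congr rfl fun x hx => by rw [(Finset.mem_filter.1 hx).2], Finset.sum_const,
      nsmul_eq_mul]
  have h2 : ∑ x ∈ s, ψ (t x) = -∑ c, ((B - (s.filter fun x => t x = c).card : ℝ) : ℂ) * ψ c := by
    rw [h1]
    push_cast
    simp_rw [sub_mul]
    rw [Finset.sum_sub_distrib, ← Finset.mul_sum, AddChar.sum_eq_zero_of_ne_one hψ]
    ring
  have h3 : ∑ c, ((s.filter fun x => t x = c).card : ℝ) = s.card := by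
    rw [← Nat.cast_sum]
    congr 1
    exact (Finset.card_eq_sum_card_fiberwise fun x _ => Finset.mem_coe.2 (Finset.mem_univ _)).symm
  rw [h2, norm_neg]
  refine (norm_sum_le _ _).trans (le_of_eq ?_)
  calc _ = ∑ c, (B - (s.filter fun x => t x = c).card) := by
        refine Finset.sum_congr rfl fun c _ => ?_
        rw [norm_mul, AddChar.norm_apply, mul_one, Complex.norm_real, Real.norm_eq_abs,
          abs_of_nonneg (sub_nonneg.2 (hB c))]
    _ = p * B - s.card := by
        rw [Finset.sum_sub_distrib, h3, Finset.sum_const, Finset.card_univ, ZMod.card, nsmul_eq_mul]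

theorem addChar_zmod_ne_one {p : ℕ} [Fact p.Prime] (ψ : AddChar (ZMod p) ℂ) (hψ : ψ ≠ 1)
    (c : ZMod p) (hc : c ≠ 0) : ψ c ≠ 1 := by
  intro h
  apply hψ
  ext x
  have : x = (x / c).val • c := by
    rw [nsmul_eq_mul, ZMod.natCast_zmod_val, div_mul_cancel₀ _ hc]
  rw [this, AddChar.map_nsmul_eq_pow, h, one_pow, AddChar.one_apply]

theorem residue_character_eq {L : Type} [Field L] {p : ℕ} [Fact p.Prime] [CharP L p]
    [Algebra (ZMod p) L] (a b : (ZMod p)[X]) (ψ : AddChar (ZMod p) ℂ) (χ : (ZMod p)[X] →* ℂ)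
    (hχ : ∀ (s : Multiset L) (G : (ZMod p)[X]),
      G.map (algebraMap (ZMod p) L) = (s.map fun θ => X - C θ).prod →
        ((∃ θ ∈ s, aeval θ b = 0) → χ G = 0) ∧
        ((∀ θ ∈ s, aeval θ b ≠ 0) → ∀ c : ZMod p,
          (s.map fun θ => aeval θ a / aeval θ b).sum = algebraMap (ZMod p) L c → χ G = ψ c))
    (n : ℕ) (hn : 1 ≤ n) (x : L) (hx : Function.IsPeriodicPt (frobenius L p) n x)
    (G : (ZMod p)[X]) (hG : G.map (algebraMap (ZMod p) L) =
      ∏ i ∈ Finset.range n, (X - C ((frobenius L p)^[i] x))) :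
    (aeval x b = 0 → χ G = 0) ∧ ∃ t : ZMod p, algebraMap (ZMod p) L t =
      ∑ i ∈ Finset.range n, (aeval x a / aeval x b) ^ p ^ i ∧ (aeval x b ≠ 0 → χ G = ψ t) := by
  have haev : ∀ (g : (ZMod p)[X]) i, aeval ((frobenius L p)^[i] x) g = (aeval x g) ^ p ^ i := by
    intro g i
    rw [aeval_def, aeval_def, ← iterate_frobenius, ← coe_iterateFrobenius, hom_eval₂]
    congr 1
    exact Subsingleton.elim _ _
  obtain ⟨h1, h2⟩ := hχ ((Finset.range n).val.map fun i => (frobenius L p)^[i] x) G (by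
    rw [hG, Multiset.map_map]
    rfl)
  constructor
  · intro h
    exact h1 ⟨x, Multiset.mem_map.2 ⟨0, Finset.mem_range.2 hn, rfl⟩, h⟩
  · have hT : frobenius L p (∑ i ∈ Finset.range n, (aeval x a / aeval x b) ^ p ^ i) =
        ∑ i ∈ Finset.range n, (aeval x a / aeval x b) ^ p ^ i := by
      rw [map_sum]
      have h := (Finset.sum_range_succ (fun i => (aeval x a / aeval x b) ^ p ^ i) n).symm.trans
        (Finset.sum_range_succ' (fun i => (aeval x a / aeval x b) ^ p ^ i) n)
      have hn0 : (aeval x a / aeval x b) ^ p ^ n = (aeval x a / aeval x b) ^ p ^ 0 := by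
        rw [div_pow, ← haev, ← haev, hx.eq]
        simp
      rw [hn0] at h
      rw [add_right_cancel h]
      refine Finset.sum_congr rfl fun i _ => ?_
      rw [frobenius_def, ← pow_mul, pow_succ]
    obtain ⟨t, ht⟩ := mem_range_algebraMap_zmod_of_frobenius p _ hT
    refine ⟨t, ht, fun hb => h2 ?_ t ?_⟩
    · intro θ hθ
      obtain ⟨i, _, rfl⟩ := Multiset.mem_map.1 hθ
      rw [haev]
      exact pow_ne_zero _ hb
    · rw [ht, Multiset.map_map]
      change ∑ i ∈ Finset.range n, _ = _
      refine Finset.sum_congr rfl fun i _ => ?_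
      rw [Function.comp_apply, haev, haev, div_pow]

theorem norm_sum_addChar_ratio_le_of_isCoprime {p : ℕ} [Fact p.Prime] (a b : (ZMod p)[X])
    (hb : b.Monic) (hab : a.degree < b.degree) (ha : a ≠ 0) (hcop : IsCoprime a b)
    (ψ : AddChar (ZMod p) ℂ) (hψ : ψ ≠ 1) (hD : 2 * b.natDegree < p) :
    ‖∑ x : ZMod p, if b.eval x = 0 then 0 else ψ (a.eval x / b.eval x)‖ ≤
      2 * b.natDegree * √p := by
  classical
  let L := AlgebraicClosure (ZMod p)
  have hchar : CharP L p := charP_of_injective_algebraMap (algebraMap (ZMod p) L).injective p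
  set D := b.natDegree with hDdef
  have haD : a.natDegree < D := natDegree_lt_natDegree ha hab
  have hp0 : (0 : ℝ) < p := by exact_mod_cast (Fact.out : p.Prime).pos
  obtain ⟨χ, hχmod, hχ⟩ := exists_residue_character (L := L) a b hb hab ψ
  have hfix : ∀ n, ∃ s : Finset L, 1 ≤ n →
      (∀ x, x ∈ s ↔ Function.IsPeriodicPt (frobenius L p) n x) ∧ s.card = p ^ n := by
    intro n
    by_cases hn : 1 ≤ n
    · obtain ⟨s, hs⟩ := exists_finset_frobenius_periodic (L := L) p n hn
      exact ⟨s, fun _ => hs⟩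
    · exact ⟨∅, fun h => absurd h hn⟩
  choose fix hfix using hfix
  have hG : ∀ n x, ∃ G : (ZMod p)[X], 1 ≤ n → x ∈ fix n → G.map (algebraMap (ZMod p) L) =
      ∏ i ∈ Finset.range n, (X - C ((frobenius L p)^[i] x)) := by
    intro n x
    by_cases hn : 1 ≤ n ∧ x ∈ fix n
    · obtain ⟨G, hG⟩ := exists_map_eq_prod_iterates p n x (((hfix n hn.1).1 x).1 hn.2)
      exact ⟨G, fun _ _ => hG⟩
    · exact ⟨0, fun h h' => absurd ⟨h, h'⟩ hn⟩
  choose G hG using hG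
  have ht : ∀ n x, ∃ t : ZMod p, 1 ≤ n → x ∈ fix n → algebraMap (ZMod p) L t =
      ∑ i ∈ Finset.range n, (aeval x a / aeval x b) ^ p ^ i ∧
      χ (G n x) = if aeval x b = 0 then 0 else ψ t := by
    intro n x
    by_cases hn : 1 ≤ n ∧ x ∈ fix n
    · obtain ⟨h1, t, h2, h3⟩ := residue_character_eq a b ψ χ hχ n hn.1 x
        (((hfix n hn.1).1 x).1 hn.2) (G n x) (hG n x hn.1 hn.2)
      refine ⟨t, fun _ _ => ⟨h2, ?_⟩⟩
      split_ifs with h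
      · exact h1 h
      · exact h3 h
    · exact ⟨0, fun h h' => absurd ⟨h, h'⟩ hn⟩
  choose t ht using ht
  set S : ℕ → ℂ := fun n => ∑ x ∈ fix n, χ (G n x) with hS
  set A : ℕ → ℂ := fun d => ∑ g ∈ monicsOfDegree (ZMod p) d, χ g with hA
  have hrec : ∀ d : ℕ, (d : ℂ) * A d = ∑ n ∈ Finset.Icc 1 d, S n * A (d - n) :=
    natDegree_mul_sum_monicsOfDegree p χ fix (fun n hn => (hfix n hn).1) G
      fun n hn x hx => hG n x hn hx
  have hinj := (algebraMap (ZMod p) L).injective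
  have haeval : ∀ (g : (ZMod p)[X]) (x : ZMod p),
      aeval (algebraMap (ZMod p) L x) g = algebraMap (ZMod p) L (g.eval x) := fun g x =>
    aeval_algebraMap_apply_eq_algebraMap_eval x g
  -- vanishing of the character sums over monic polynomials of large degree
  have hAvan : ∀ d, 2 * D ≤ d → A d = 0 := by
    intro d hd
    have hab0 : a * b ≠ 0 := mul_ne_zero ha hb.ne_zero
    obtain ⟨x0, hx0⟩ : ∃ x0 : ZMod p, (a * b).eval x0 ≠ 0 := by
      by_contra! h
      apply hab0
      refine eq_zero_of_natDegree_lt_card_of_eval_eq_zero (a * b) (f := id) Function.injective_id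
        (fun i => h i) ?_
      rw [natDegree_mul ha hb.ne_zero, ZMod.card]
      omega
    rw [eval_mul] at hx0
    have hax := left_ne_zero_of_mul hx0
    have hbx := right_ne_zero_of_mul hx0
    refine sum_monicsOfDegree_eq_zero χ (b ^ 2) (hb.pow 2) hχmod (X - C x0) ?_ ?_ d ?_
    · refine (IsCoprime.pow_left ?_)
      refine ((irreducible_X_sub_C x0).coprime_iff_not_dvd.2 ?_).symm
      rwa [dvd_iff_isRoot]
    · have h := (hχ {algebraMap (ZMod p) L x0} (X - C x0) (by simp)).2 (by
        simp only [Multiset.mem_singleton, forall_eq]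
        rw [haeval]
        simpa using hbx) (a.eval x0 / b.eval x0) (by simp [haeval])
      rw [h]
      exact addChar_zmod_ne_one ψ hψ _ (div_ne_zero hax hbx)
    · rw [hb.natDegree_pow]
      exact hd
  -- the Stepanov estimate over even degree extensions
  obtain ⟨β, hβ⟩ : ∃ β : L, (b.map (algebraMap (ZMod p) L)).IsRoot β := by
    apply IsAlgClosed.exists_root
    rw [degree_map]
    intro h
    have : b.natDegree = 0 := natDegree_eq_of_degree_eq_some h
    omega
  have hβa : (a.map (algebraMap (ZMod p) L)).eval β ≠ 0 := by
    intro h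
    obtain ⟨u, v, huv⟩ := hcop.map (mapRingHom (algebraMap (ZMod p) L))
    have := congrArg (eval β) huv
    rw [coe_mapRingHom, eval_add, eval_mul, eval_mul, h, hβ.eq_zero] at this
    simp at this
  have hSbound : ∀ m, 1 ≤ m → ‖S (2 * m)‖ ≤ ((2 * D + 2) * p + D : ℝ) * (p : ℝ) ^ m := by
    intro m hm
    have h1m : 1 ≤ 2 * m := by omega
    set s := (fix (2 * m)).filter fun x => aeval x b ≠ 0 with hs
    have e1 : S (2 * m) = ∑ x ∈ s, ψ (t (2 * m) x) := by
      rw [hs, Finset.sum_filter]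
      refine Finset.sum_congr rfl fun x hx => ?_
      rw [(ht _ x h1m hx).2]
      simp only [ne_eq, ite_not]
    have hcard : (p : ℝ) ^ (2 * m) - D ≤ s.card := by
      have h1 : s.card + ((fix (2 * m)).filter fun x => ¬ aeval x b ≠ 0).card =
          (fix (2 * m)).card := Finset.card_filter_add_card_filter_not _
      have h2 : ((fix (2 * m)).filter fun x => ¬ aeval x b ≠ 0).card ≤ D := by
        have hb0 : b.map (algebraMap (ZMod p) L) ≠ 0 := (hb.map _).ne_zero
        refine (Finset.card_le_card (t := (b.map (algebraMap (ZMod p) L)).roots.toFinset) ?_).trans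
          ((Multiset.toFinset_card_le _).trans ((card_roots' _).trans natDegree_map_le))
        intro x hx
        rw [Multiset.mem_toFinset, mem_roots hb0, IsRoot, eval_map_algebraMap]
        simpa using (Finset.mem_filter.1 hx).2
      rw [(hfix _ h1m).2] at h1
      have h3 : p ^ (2 * m) ≤ s.card + D := by omega
      have : ((p ^ (2 * m) : ℕ) : ℝ) ≤ ((s.card + D : ℕ) : ℝ) := by exact_mod_cast h3
      push_cast at this
      linarith
    have hfiber : ∀ c, ((s.filter fun x => t (2 * m) x = c).card : ℝ) ≤
        (p : ℝ) ^ (m - 1) * p ^ m + (2 * D + 2) * p ^ m := by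
      intro c
      have := stepanov_bound p (a.map (algebraMap (ZMod p) L)) (b.map (algebraMap (ZMod p) L)) D
        (natDegree_map_le.trans haD.le) natDegree_map_le (by omega) (hb.map _).ne_zero β hβ hβa
        (algebraMap (ZMod p) L c) m hm (s.filter fun x => t (2 * m) x = c) (by
          intro α hα
          obtain ⟨h1, h2⟩ := Finset.mem_filter.1 hα
          obtain ⟨h3, h4⟩ := Finset.mem_filter.1 h1
          rw [eval_map_algebraMap, eval_map_algebraMap]
          refine ⟨?_, h4, ?_⟩
          · have := ((hfix _ h1m).1 α).1 h3
            rwa [Function.IsPeriodicPt, Function.IsFixedPt, iterate_frobenius] at this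
          · rw [← (ht _ α h1m h3).1, h2])
      exact_mod_cast this
    rw [e1]
    refine (norm_sum_addChar_le_of_fiber_card_le s _ ψ hψ _ hfiber).trans ?_
    have hpow : (p : ℝ) * (p ^ (m - 1) * p ^ m) = p ^ (2 * m) := by
      rw [← pow_add, ← pow_succ']
      congr 1
      omega
    have hpm : (1 : ℝ) ≤ (p : ℝ) ^ m :=
      one_le_pow₀ (by exact_mod_cast (Fact.out : p.Prime).one_lt.le)
    have hD0 : (0 : ℝ) ≤ D := Nat.cast_nonneg D
    nlinarith
  have hfinal := norm_le_of_newton_recurrence A S (2 * D) (sum_monicsOfDegree_zero χ) hAvan hrec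
    _ p hp0 hSbound
  have hS1 : S 1 = ∑ x : ZMod p, if b.eval x = 0 then 0 else ψ (a.eval x / b.eval x) := by
    symm
    refine Finset.sum_nbij (algebraMap (ZMod p) L) ?_ hinj.injOn ?_ ?_
    · intro x _
      rw [(hfix 1 le_rfl).1, Function.IsPeriodicPt, Function.IsFixedPt, Function.iterate_one,
        frobenius_def, ← map_pow, ZMod.pow_card]
    · intro x hx
      rw [Finset.mem_coe, (hfix 1 le_rfl).1] at hx
      obtain ⟨z, rfl⟩ := mem_range_algebraMap_zmod_of_frobenius p x hx
      exact ⟨z, by simp, rfl⟩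
    · intro x _
      obtain ⟨h1, h2⟩ := ht 1 (algebraMap (ZMod p) L x) le_rfl (by
        rw [(hfix 1 le_rfl).1, Function.IsPeriodicPt, Function.IsFixedPt, Function.iterate_one,
          frobenius_def, ← map_pow, ZMod.pow_card])
      rw [h2]
      simp only [Finset.sum_range_one, pow_zero, pow_one, haeval, ← map_div₀] at h1
      rw [hinj h1, haeval]
      simp
  rw [← hS1]
  push_cast at hfinal
  exact hfinal

theorem norm_sum_addChar_ratio_le_of_degree_lt {p : ℕ} [Fact p.Prime] (a b : (ZMod p)[X])
    (hab : a.degree < b.degree) (ha : a ≠ 0) (ψ : AddChar (ZMod p) ℂ) (hψ : ψ ≠ 1)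
    (hD : 2 * b.natDegree < p) :
    ‖∑ x : ZMod p, if b.eval x = 0 then 0 else ψ (a.eval x / b.eval x)‖ ≤
      2 * b.natDegree * √p + b.natDegree := by
  classical
  have hb : b ≠ 0 := by
    rintro rfl
    simp at hab
  obtain ⟨g, a2, b2, hg, hb2, hcop, rfl, rfl⟩ : ∃ g a2 b2 : (ZMod p)[X], g ≠ 0 ∧ b2.Monic ∧
      IsCoprime a2 b2 ∧ a = g * a2 ∧ b = g * b2 := by
    set g := EuclideanDomain.gcd a b with hgdef
    have hg : g ≠ 0 := fun h => hb (EuclideanDomain.gcd_eq_zero_iff.1 h).2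
    obtain ⟨a1, ha1⟩ := EuclideanDomain.gcd_dvd_left a b
    obtain ⟨b1, hb1⟩ := EuclideanDomain.gcd_dvd_right a b
    rw [← hgdef] at ha1 hb1
    have hb10 : b1 ≠ 0 := by
      rintro rfl
      exact hb (by rw [hb1, mul_zero])
    have hcop : IsCoprime a1 b1 := by
      have h := EuclideanDomain.gcd_eq_gcd_ab a b
      rw [← hgdef] at h
      set u := EuclideanDomain.gcdA a b
      set v := EuclideanDomain.gcdB a b
      refine ⟨u, v, mul_left_cancel₀ hg ?_⟩
      calc g * (u * a1 + v * b1) = (g * a1) * u + (g * b1) * v := by ring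
        _ = g * 1 := by rw [← ha1, ← hb1, ← h, mul_one]
    have hl : b1.leadingCoeff ≠ 0 := leadingCoeff_ne_zero.2 hb10
    have hu : IsUnit (C (b1.leadingCoeff)⁻¹) := isUnit_C.2 (isUnit_iff_ne_zero.2 (inv_ne_zero hl))
    have hCC : C b1.leadingCoeff * C (b1.leadingCoeff)⁻¹ = 1 := by
      rw [← C_mul, mul_inv_cancel₀ hl, C_1]
    refine ⟨g * C b1.leadingCoeff, a1 * C (b1.leadingCoeff)⁻¹, b1 * C (b1.leadingCoeff)⁻¹,
      mul_ne_zero hg (C_ne_zero.2 hl), monic_mul_leadingCoeff_inv hb10, ?_, ?_, ?_⟩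
    · rw [isCoprime_mul_unit_right hu]
      exact hcop
    · rw [mul_mul_mul_comm, hCC, mul_one]
      exact ha1
    · rw [mul_mul_mul_comm, hCC, mul_one]
      exact hb1
  have ha2 : a2 ≠ 0 := right_ne_zero_of_mul ha
  have hnat : (g * b2).natDegree = g.natDegree + b2.natDegree := natDegree_mul hg hb2.ne_zero
  have hab2 : a2.degree < b2.degree := by
    rw [degree_mul, degree_mul] at hab
    exact lt_of_add_lt_add_left hab
  have h := norm_sum_addChar_ratio_le_of_isCoprime a2 b2 hb2 hab2 ha2 hcop ψ hψ (by omega)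
  have hdiff : ‖(∑ x : ZMod p, if (g * b2).eval x = 0 then 0 else
      ψ ((g * a2).eval x / (g * b2).eval x)) -
      ∑ x : ZMod p, if b2.eval x = 0 then 0 else ψ (a2.eval x / b2.eval x)‖ ≤ g.natDegree := by
    rw [← Finset.sum_sub_distrib]
    refine (norm_sum_le _ _).trans ?_
    calc _ ≤ ∑ x : ZMod p, (if x ∈ g.roots.toFinset then 1 else 0 : ℝ) := by
          refine Finset.sum_le_sum fun x _ => ?_
          simp only [Multiset.mem_toFinset, mem_roots hg, IsRoot, eval_mul]
          by_cases hgx : g.eval x = 0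
          · simp only [hgx, zero_mul, if_true, zero_sub, norm_neg]
            split_ifs <;> simp [AddChar.norm_apply]
          · simp [hgx, mul_div_mul_left]
      _ = (g.roots.toFinset.card : ℝ) := by
          rw [Finset.sum_ite_mem, Finset.univ_inter]
          simp
      _ ≤ g.natDegree := by
          exact_mod_cast (Multiset.toFinset_card_le _).trans (card_roots' _)
  have hle := norm_sub_norm_le (∑ x : ZMod p, if (g * b2).eval x = 0 then 0 else
      ψ ((g * a2).eval x / (g * b2).eval x))
      (∑ x : ZMod p, if b2.eval x = 0 then 0 else ψ (a2.eval x / b2.eval x))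
  rw [hnat]
  push_cast
  have : 0 ≤ (g.natDegree : ℝ) * √p := by positivity
  have : 0 ≤ (b2.natDegree : ℝ) := by positivity
  linarith

theorem norm_sum_addChar_ratio_le_of_natDegree_le {p : ℕ} [Fact p.Prime] (a b : (ZMod p)[X])
    (hdeg : a.natDegree ≤ b.natDegree) (hb : b ≠ 0) (hab : ∀ c, a ≠ C c * b)
    (ψ : AddChar (ZMod p) ℂ) (hψ : ψ ≠ 1) (hD : 2 * b.natDegree < p) :
    ‖∑ x : ZMod p, if b.eval x = 0 then 0 else ψ (a.eval x / b.eval x)‖ ≤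
      2 * b.natDegree * √p + b.natDegree := by
  set c := a.coeff b.natDegree / b.leadingCoeff with hc
  have hlt : (a - C c * b).degree < b.degree := by
    rw [degree_eq_natDegree hb, degree_lt_iff_coeff_zero]
    intro m hm
    rcases hm.eq_or_lt with rfl | hm
    · rw [coeff_sub, coeff_C_mul, coeff_natDegree, hc,
        div_mul_cancel₀ _ (leadingCoeff_ne_zero.2 hb), sub_self]
    · rw [coeff_sub, coeff_C_mul, coeff_eq_zero_of_natDegree_lt hm,
        coeff_eq_zero_of_natDegree_lt (hdeg.trans_lt hm)]
      simp
  have h := norm_sum_addChar_ratio_le_of_degree_lt (a - C c * b) b hlt (sub_ne_zero.2 (hab c)) ψ hψ hD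
  refine le_trans (le_of_eq ?_) h
  have : (∑ x : ZMod p, if b.eval x = 0 then 0 else ψ (a.eval x / b.eval x)) =
      ψ c * ∑ x : ZMod p, if b.eval x = 0 then 0 else ψ ((a - C c * b).eval x / b.eval x) := by
    rw [Finset.mul_sum]
    refine Finset.sum_congr rfl fun x _ => ?_
    split_ifs with hx
    · simp
    · rw [← AddChar.map_add_eq_mul]
      congr 1
      rw [eval_sub, eval_mul, eval_C]
      field_simp
      ring
  rw [this, norm_mul, AddChar.norm_apply, one_mul]

theorem eval_reflect_inv {F : Type*} [Field F] (N : ℕ) (f : F[X]) (hf : f.natDegree ≤ N) (x : F)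
    (hx : x ≠ 0) : (reflect N f).eval x * (x⁻¹) ^ N = f.eval x⁻¹ := by
  have := invertibleOfNonzero (inv_ne_zero hx)
  have h := eval₂_reflect_mul_pow (RingHom.id F) x⁻¹ N f hf
  rwa [invOf_eq_inv, inv_inv] at h

theorem norm_sum_addChar_ratio_le {p : ℕ} [Fact p.Prime] (a b : (ZMod p)[X]) (D : ℕ)
    (ha : a.natDegree ≤ D) (hbD : b.natDegree ≤ D) (hb : b ≠ 0) (hab : ∀ c, a ≠ C c * b)
    (ψ : AddChar (ZMod p) ℂ) (hψ : ψ ≠ 1) (hD : 2 * D < p) :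
    ‖∑ x : ZMod p, if b.eval x = 0 then 0 else ψ (a.eval x / b.eval x)‖ ≤
      2 * D * √p + D + 2 := by
  classical
  obtain ⟨c, hc⟩ : ∃ c : ZMod p, b.eval c ≠ 0 := by
    by_contra! h
    refine hb (eq_zero_of_natDegree_lt_card_of_eval_eq_zero b (f := id) Function.injective_id
      (fun i => h i) ?_)
    rw [ZMod.card]
    omega
  set A := reflect D (taylor c a) with hA
  set B := reflect D (taylor c b) with hB
  have hrefl : ∀ f : (ZMod p)[X], f.natDegree ≤ D → (reflect D (taylor c f)).natDegree ≤ D := by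
    intro f hf
    rw [natDegree_le_iff_coeff_eq_zero]
    intro m hm
    rw [coeff_reflect, revAt_eq_self_of_lt hm, coeff_eq_zero_of_natDegree_lt]
    rw [natDegree_taylor]
    omega
  have hBD : B.natDegree = D := by
    refine le_antisymm (hrefl b hbD) (le_natDegree_of_ne_zero ?_)
    rw [hB, coeff_reflect, revAt_le le_rfl, Nat.sub_self, taylor_coeff_zero]
    exact hc
  have hB0 : B ≠ 0 := by
    rw [hB, Ne, reflect_eq_zero_iff, taylor_eq_zero]
    exact hb
  have hAB : ∀ k, A ≠ C k * B := by
    intro k h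
    apply hab k
    apply taylor_injective c
    rw [taylor_mul, taylor_C, ← sub_eq_zero, ← reflect_eq_zero_iff (N := D), reflect_sub,
      reflect_C_mul, sub_eq_zero]
    exact h
  have h := norm_sum_addChar_ratio_le_of_natDegree_le A B (by rw [hBD]; exact hrefl a ha) hB0 hAB
    ψ hψ (by rw [hBD]; exact hD)
  rw [hBD] at h
  set F : ZMod p → ℂ := fun x => if b.eval x = 0 then 0 else ψ (a.eval x / b.eval x) with hF
  set H : ZMod p → ℂ := fun x => if B.eval x = 0 then 0 else ψ (A.eval x / B.eval x) with hH
  have hFn : ∀ x, ‖F x‖ ≤ 1 := by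
    intro x
    simp only [hF]
    split_ifs <;> simp [AddChar.norm_apply]
  have hHn : ∀ x, ‖H x‖ ≤ 1 := by
    intro x
    simp only [hH]
    split_ifs <;> simp [AddChar.norm_apply]
  have hFH : ∀ u, u ≠ 0 → F (u⁻¹ + c) = H u := by
    intro u hu
    have hpow : (u⁻¹) ^ D ≠ 0 := pow_ne_zero _ (inv_ne_zero hu)
    have e1 := eval_reflect_inv D (taylor c a) (by rwa [natDegree_taylor]) u hu
    have e2 := eval_reflect_inv D (taylor c b) (by rwa [natDegree_taylor]) u hu
    rw [taylor_eval] at e1 e2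
    simp only [hF, hH]
    rw [← e1, ← e2, mul_div_mul_right _ _ hpow]
    simp [hu, hA, hB]
  have hsum : ∑ x, F x - F c = ∑ u, H u - H 0 := by
    rw [← Finset.sum_erase_eq_sub (Finset.mem_univ c), ← Finset.sum_erase_eq_sub (Finset.mem_univ 0)]
    symm
    refine Finset.sum_bij' (fun u _ => u⁻¹ + c) (fun x _ => (x - c)⁻¹) ?_ ?_ ?_ ?_ ?_
    · intro u hu
      simpa using hu
    · intro x hx
      simpa [sub_eq_zero] using hx
    · intro u hu
      simp
    · intro x hx
      simp
    · intro u hu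
      exact (hFH u (by simpa using hu)).symm
  have e : ∑ x, F x = ∑ u, H u + (F c - H 0) := by
    linear_combination hsum
  rw [e]
  have h1 := norm_add_le (∑ u, H u) (F c - H 0)
  have h2 := norm_sub_le (F c) (H 0)
  have h3 := hFn c
  have h4 := hHn 0
  linarith

theorem sum_norm_sq_sum_mul_addChar {p : ℕ} [Fact p.Prime] (ψ : AddChar (ZMod p) ℂ)
    (hψ : ψ.IsPrimitive) (f : ZMod p → ℂ) :
    ∑ ξ, ‖∑ x, f x * ψ (ξ * x)‖ ^ 2 = p * ∑ x, ‖f x‖ ^ 2 := by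
  apply Complex.ofReal_injective
  push_cast
  have h1 : ∀ ξ : ZMod p, ((‖∑ x, f x * ψ (ξ * x)‖ : ℂ)) ^ 2 =
      ∑ x, ∑ y, f x * (starRingEnd ℂ) (f y) * ψ (ξ * (x - y)) := by
    intro ξ
    rw [← Complex.mul_conj', map_sum, Finset.sum_mul_sum]
    refine Finset.sum_congr rfl fun x _ => Finset.sum_congr rfl fun y _ => ?_
    rw [map_mul (starRingEnd ℂ), ← AddChar.map_neg_eq_conj, mul_sub, sub_eq_add_neg,
      AddChar.map_add_eq_mul]
    ring
  rw [Finset.sum_congr rfl fun ξ _ => h1 ξ, Finset.sum_comm, Finset.mul_sum]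
  refine Finset.sum_congr rfl fun x _ => ?_
  rw [Finset.sum_comm]
  have h2 : ∀ y, ∑ ξ, f x * (starRingEnd ℂ) (f y) * ψ (ξ * (x - y)) =
      if x = y then (p : ℂ) * (f x * (starRingEnd ℂ) (f x)) else 0 := by
    intro y
    rw [← Finset.mul_sum, AddChar.sum_mulShift _ hψ, ZMod.card]
    by_cases h : x = y
    · simp [h, mul_comm]
    · simp [h, sub_eq_zero]
  rw [Finset.sum_congr rfl fun y _ => h2 y, Finset.sum_ite_eq, if_pos (Finset.mem_univ x),
    Complex.mul_conj']

theorem sum_mul_addChar_inversion {p : ℕ} [Fact p.Prime] (ψ : AddChar (ZMod p) ℂ)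
    (hψ : ψ.IsPrimitive) (f : ZMod p → ℂ) (z : ZMod p) :
    (p : ℂ) * f z = ∑ ξ, (∑ x, f x * ψ (ξ * x)) * ψ (-(ξ * z)) := by
  have h1 : ∀ ξ : ZMod p, (∑ x, f x * ψ (ξ * x)) * ψ (-(ξ * z)) = ∑ x, f x * ψ (ξ * (x - z)) := by
    intro ξ
    rw [Finset.sum_mul]
    refine Finset.sum_congr rfl fun x _ => ?_
    rw [mul_sub, sub_eq_add_neg, AddChar.map_add_eq_mul, mul_assoc]
  simp_rw [h1]
  rw [Finset.sum_comm]
  simp_rw [← Finset.mul_sum, AddChar.sum_mulShift _ hψ, sub_eq_zero]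
  simp [mul_comm]

theorem norm_correlation_sub_le {p : ℕ} [Fact p.Prime] {ι : Type*} (s : Finset ι)
    (v : ι → ZMod p) (K : ℝ)
    (hK : ∀ ψ : AddChar (ZMod p) ℂ, ‖∑ y ∈ s, ψ (v y) - ∑ a, ψ a‖ ≤ K) (f g : ZMod p → ℂ)
    (hf : ∀ x, ‖f x‖ ≤ 1) (hg : ∀ x, ‖g x‖ ≤ 1) :
    ‖∑ x, ∑ y ∈ s, f x * g (x + v y) - ∑ x, f x * ∑ a, g a‖ ≤ K * p := by
  have hp0 : (0 : ℝ) < p := by exact_mod_cast (Fact.out : p.Prime).pos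
  set ψ : AddChar (ZMod p) ℂ := ZMod.stdAddChar with hψdef
  have hψ : ψ.IsPrimitive := ZMod.isPrimitive_stdAddChar p
  set F : ZMod p → ℂ := fun ξ => ∑ x, f x * ψ (ξ * x) with hF
  set G : ZMod p → ℂ := fun ξ => ∑ x, g x * ψ (ξ * x) with hG
  set E : ZMod p → ℂ := fun ξ => ∑ y ∈ s, ψ (-(ξ * v y)) - ∑ a, ψ (-(ξ * a)) with hE
  have hEK : ∀ ξ, ‖E ξ‖ ≤ K := by
    intro ξ
    have := hK (ψ.mulShift (-ξ))
    simpa only [AddChar.mulShift_apply, neg_mul] using this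
  have hK0 : 0 ≤ K := (norm_nonneg _).trans (hEK 0)
  have key : (p : ℂ) * (∑ x, ∑ y ∈ s, f x * g (x + v y) - ∑ x, f x * ∑ a, g a) =
      ∑ ξ, F (-ξ) * (G ξ * E ξ) := by
    have hx : ∀ x, (p : ℂ) * (∑ y ∈ s, f x * g (x + v y) - f x * ∑ a, g a) =
        ∑ ξ, f x * ψ (-ξ * x) * (G ξ * E ξ) := by
      intro x
      have h1 : ∑ a, g a = ∑ a, g (x + a) := (Equiv.sum_comp (Equiv.addLeft x) g).symm
      have h2 : ∀ a, (p : ℂ) * g (x + a) = ∑ ξ, ψ (-ξ * x) * G ξ * ψ (-(ξ * a)) := by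
        intro a
        rw [sum_mul_addChar_inversion ψ hψ g]
        refine Finset.sum_congr rfl fun ξ _ => ?_
        rw [mul_add, neg_add, AddChar.map_add_eq_mul, neg_mul]
        ring
      rw [h1, ← Finset.mul_sum, ← mul_sub, mul_left_comm, mul_sub, Finset.mul_sum, Finset.mul_sum]
      simp_rw [h2]
      rw [Finset.sum_comm (s := s), Finset.sum_comm (s := Finset.univ) (t := Finset.univ)
        (f := fun a ξ => ψ (-ξ * x) * G ξ * ψ (-(ξ * a))), ← Finset.sum_sub_distrib,
        Finset.mul_sum]
      refine Finset.sum_congr rfl fun ξ _ => ?_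
      rw [← Finset.mul_sum, ← Finset.mul_sum, ← mul_sub]
      ring
    rw [← Finset.sum_sub_distrib, Finset.mul_sum]
    simp_rw [hx]
    rw [Finset.sum_comm]
    refine Finset.sum_congr rfl fun ξ _ => ?_
    rw [← Finset.sum_mul]
  have hpars : ∀ h : ZMod p → ℂ, (∀ x, ‖h x‖ ≤ 1) →
      ∑ ξ, ‖∑ x, h x * ψ (ξ * x)‖ ^ 2 ≤ (p : ℝ) * p := by
    intro h hh
    rw [sum_norm_sq_sum_mul_addChar ψ hψ]
    refine mul_le_mul_of_nonneg_left ?_ hp0.le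
    calc ∑ x, ‖h x‖ ^ 2 ≤ ∑ x : ZMod p, (1 : ℝ) :=
          Finset.sum_le_sum fun x _ => pow_le_one₀ (norm_nonneg _) (hh x)
      _ = p := by simp
  have hFneg : ∑ ξ, ‖F (-ξ)‖ ^ 2 ≤ (p : ℝ) * p := by
    rw [show ∑ ξ, ‖F (-ξ)‖ ^ 2 = ∑ ξ, ‖F ξ‖ ^ 2 from
      Equiv.sum_comp (Equiv.neg (ZMod p)) fun ξ => ‖F ξ‖ ^ 2]
    exact hpars f hf
  have hbound : ‖∑ ξ, F (-ξ) * (G ξ * E ξ)‖ ≤ K * (p * p) := by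
    calc ‖∑ ξ, F (-ξ) * (G ξ * E ξ)‖ ≤ ∑ ξ, K * ((‖F (-ξ)‖ ^ 2 + ‖G ξ‖ ^ 2) / 2) := by
          refine (norm_sum_le _ _).trans (Finset.sum_le_sum fun ξ _ => ?_)
          rw [norm_mul, norm_mul, ← mul_assoc, mul_comm]
          refine mul_le_mul (hEK ξ) ?_ (by positivity) hK0
          nlinarith [sq_nonneg (‖F (-ξ)‖ - ‖G ξ‖)]
      _ ≤ K * (p * p) := by
          rw [← Finset.mul_sum, ← Finset.sum_div, Finset.sum_add_distrib]
          refine mul_le_mul_of_nonneg_left ?_ hK0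
          linarith [hpars g hg]
  rw [← key, norm_mul, Complex.norm_natCast] at hbound
  refine le_of_mul_le_mul_left (hbound.trans (le_of_eq ?_)) hp0
  ring

theorem ratRed_zero (p : ℕ) : ratRed p 0 = 0 := by simp [ratRed]

theorem ratRed_one (p : ℕ) : ratRed p 1 = 1 := by simp [ratRed]

theorem ratRed_mul_den (p : ℕ) [Fact p.Prime] (q : ℚ) (hq : ¬ p ∣ q.den) :
    ratRed p q * q.den = q.num := by
  have : (q.den : ZMod p) ≠ 0 := by rwa [Ne, ZMod.natCast_eq_zero_iff]
  rw [ratRed, mul_assoc, inv_mul_cancel₀ this, mul_one]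

theorem exists_ratRed_ne_mul {q r s : ℚ} (h : q ≠ r * s) :
    ∃ N : ℕ, ∀ (p : ℕ) [Fact p.Prime], N ≤ p → ¬ p ∣ q.den → ¬ p ∣ r.den → ¬ p ∣ s.den →
      ratRed p q ≠ ratRed p r * ratRed p s := by
  set Z : ℤ := q.num * r.den * s.den - r.num * s.num * q.den with hZ
  have hZ0 : Z ≠ 0 := by
    intro h0
    apply h
    have h1 : (q.num : ℚ) * r.den * s.den - r.num * s.num * q.den = 0 := by
      exact_mod_cast h0
    have hd : (q.den * r.den * s.den : ℚ) ≠ 0 := by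
      exact_mod_cast mul_ne_zero (mul_ne_zero q.den_ne_zero r.den_ne_zero) s.den_ne_zero
    rw [← Rat.mul_den_eq_num q, ← Rat.mul_den_eq_num r, ← Rat.mul_den_eq_num s] at h1
    have h2 : (q.den * r.den * s.den : ℚ) * (q - r * s) = 0 := by linear_combination h1
    exact sub_eq_zero.mp ((mul_eq_zero.mp h2).resolve_left hd)
  refine ⟨Z.natAbs + 1, fun p _ hp hq hr hs heq => ?_⟩
  have e : (Z : ZMod p) = 0 := by
    rw [hZ]
    push_cast
    rw [← ratRed_mul_den p q hq, ← ratRed_mul_den p r hr, ← ratRed_mul_den p s hs, heq]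
    ring
  rw [ZMod.intCast_zmod_eq_zero_iff_dvd, Int.natCast_dvd] at e
  have := Nat.le_of_dvd (Int.natAbs_pos.mpr hZ0) e
  omega

theorem polyRed_coeff (p : ℕ) (f : ℚ[X]) (n : ℕ) :
    (polyRed p f).coeff n = ratRed p (f.coeff n) := by
  rw [polyRed, Polynomial.sum_def, finsetSum_coeff]
  simp only [coeff_C_mul_X_pow]
  rw [Finset.sum_ite_eq]
  split_ifs with h
  · rfl
  · rw [notMem_support_iff.mp h, ratRed_zero]

theorem natDegree_polyRed_le (p : ℕ) (f : ℚ[X]) : (polyRed p f).natDegree ≤ f.natDegree := by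
  rw [natDegree_le_iff_coeff_eq_zero]
  intro n hn
  rw [polyRed_coeff, coeff_eq_zero_of_natDegree_lt hn, ratRed_zero]

theorem polyRed_coeff_natDegree_of_monic (p : ℕ) {f : ℚ[X]} (hf : f.Monic) :
    (polyRed p f).coeff f.natDegree = 1 := by
  rw [polyRed_coeff, hf.coeff_natDegree, ratRed_one]

theorem polyRed_ne_zero_of_monic (p : ℕ) [Fact p.Prime] {f : ℚ[X]} (hf : f.Monic) :
    polyRed p f ≠ 0 := by
  intro h
  have := polyRed_coeff_natDegree_of_monic p hf
  simp [h] at this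

theorem exists_polyRed_num_ne_C_mul (P : RatFunc ℚ) (hP : ∀ c : ℚ, P ≠ RatFunc.C c) :
    ∃ N : ℕ, ∀ (p : ℕ) [Fact p.Prime], N ≤ p → Admissible p P →
      ∀ c, polyRed p P.num ≠ C c * polyRed p P.denom := by
  have hmon : P.denom.Monic := RatFunc.monic_denom P
  obtain ⟨i, hi⟩ : ∃ i, P.num.coeff i ≠ P.num.coeff P.denom.natDegree * P.denom.coeff i := by
    by_contra! h
    apply hP (P.num.coeff P.denom.natDegree)
    have e : P.num = C (P.num.coeff P.denom.natDegree) * P.denom := by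
      ext i
      rw [coeff_C_mul]
      exact h i
    have hd : algebraMap ℚ[X] (RatFunc ℚ) P.denom ≠ 0 := RatFunc.algebraMap_ne_zero P.denom_ne_zero
    have e2 := RatFunc.num_div_denom P
    rw [e, map_mul, mul_div_cancel_right₀ _ hd, RatFunc.algebraMap_C] at e2
    exact e2.symm
  obtain ⟨N, hN⟩ := exists_ratRed_ne_mul hi
  refine ⟨N, fun p _ hp hadm c hc => ?_⟩
  have h1 := congrArg (fun f => coeff f P.denom.natDegree) hc
  have h2 := congrArg (fun f => coeff f i) hc
  simp only [coeff_C_mul, polyRed_coeff_natDegree_of_monic p hmon, mul_one] at h1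
  simp only [coeff_C_mul, polyRed_coeff] at h1 h2
  rw [← h1] at h2
  exact hN p hp (hadm.1 _) (hadm.1 _) (hadm.2 _) h2

theorem card_isPole_le (p : ℕ) [Fact p.Prime] (P : RatFunc ℚ) :
    (Finset.univ.filter fun y => IsPole p P y).card ≤ P.denom.natDegree := by
  have h0 : polyRed p P.denom ≠ 0 := polyRed_ne_zero_of_monic p (RatFunc.monic_denom P)
  refine le_trans ?_ (natDegree_polyRed_le p P.denom)
  refine le_trans ?_ (card_roots' _)
  refine le_trans (Finset.card_le_card fun y hy => ?_) (Multiset.toFinset_card_le _)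
  rw [Multiset.mem_toFinset, mem_roots h0]
  exact (Finset.mem_filter.mp hy).2

theorem norm_sum_addChar_evalRed_sub_le (P : RatFunc ℚ) (hP : ∀ c : ℚ, P ≠ RatFunc.C c) :
    ∃ K : ℝ, 0 < K ∧ ∀ (p : ℕ) [Fact p.Prime], Admissible p P → ∀ ψ : AddChar (ZMod p) ℂ,
      ‖∑ y with ¬ IsPole p P y, ψ (evalRed p P y) - ∑ a, ψ a‖ ≤ K * √p := by
  obtain ⟨N, hN⟩ := exists_polyRed_num_ne_C_mul P hP
  set D : ℕ := max P.num.natDegree P.denom.natDegree with hD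
  set M : ℕ := max N (2 * D + 1) with hM
  refine ⟨3 * D + 2 + 2 * √M, by positivity, fun p _ hadm ψ => ?_⟩
  have hp1 : (1 : ℝ) ≤ p := by exact_mod_cast (Fact.out : p.Prime).one_le
  have hs1 : 1 ≤ √(p : ℝ) := Real.one_le_sqrt.mpr hp1
  have hD0 : (0 : ℝ) ≤ D := Nat.cast_nonneg D
  rcases lt_or_ge p M with hpM | hpM
  · have h1 : ‖∑ y with ¬ IsPole p P y, ψ (evalRed p P y)‖ ≤ p := by
      refine (norm_sum_le _ _).trans ?_
      simp only [AddChar.norm_apply, Finset.sum_const, nsmul_eq_mul, mul_one]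
      exact_mod_cast (Finset.card_le_univ _).trans (ZMod.card p).le
    have h2 : ‖∑ a, ψ a‖ ≤ p := by
      refine (norm_sum_le _ _).trans ?_
      simp [AddChar.norm_apply]
    have h3 : √(p : ℝ) ≤ √(M : ℝ) := Real.sqrt_le_sqrt (by exact_mod_cast hpM.le)
    have h4 : (p : ℝ) = √p * √p := (Real.mul_self_sqrt (by positivity)).symm
    have h5 : √(p : ℝ) * √p ≤ √M * √p := mul_le_mul_of_nonneg_right h3 (by positivity)
    have h6 : 0 ≤ (3 * D + 2 : ℝ) * √p := by positivity
    have h7 := norm_sub_le (∑ y with ¬ IsPole p P y, ψ (evalRed p P y)) (∑ a, ψ a)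
    linarith
  · have hbound : ‖∑ y with ¬ IsPole p P y, ψ (evalRed p P y) - ∑ a, ψ a‖ ≤
        2 * D * √p + D + 2 := by
      rcases eq_or_ne ψ 1 with rfl | hψ
      · have e : ∑ y with ¬ IsPole p P y, (1 : AddChar (ZMod p) ℂ) (evalRed p P y) -
            ∑ a, (1 : AddChar (ZMod p) ℂ) a =
            -((Finset.univ.filter fun y => IsPole p P y).card : ℂ) := by
          have := Finset.card_filter_add_card_filter_not (s := (Finset.univ : Finset (ZMod p)))
            (fun y => IsPole p P y)
          have h : ((Finset.univ.filter fun y => IsPole p P y).card : ℂ) +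
              (Finset.univ.filter fun y => ¬ IsPole p P y).card =
              (Finset.univ : Finset (ZMod p)).card := by exact_mod_cast this
          simp only [AddChar.one_apply, Finset.sum_const, nsmul_eq_mul, mul_one]
          linear_combination h
        rw [e, norm_neg, Complex.norm_natCast]
        have : ((Finset.univ.filter fun y => IsPole p P y).card : ℝ) ≤ D := by
          exact_mod_cast (card_isPole_le p P).trans (le_max_right _ _)
        have : 0 ≤ 2 * D * √(p : ℝ) := by positivity
        linarith
      · rw [AddChar.sum_eq_zero_of_ne_one hψ, sub_zero]
        have := norm_sum_addChar_ratio_le (polyRed p P.num) (polyRed p P.denom) D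
          ((natDegree_polyRed_le p _).trans (le_max_left _ _))
          ((natDegree_polyRed_le p _).trans (le_max_right _ _))
          (polyRed_ne_zero_of_monic p (RatFunc.monic_denom P))
          (hN p ((le_max_left _ _).trans hpM) hadm) ψ hψ
          (lt_of_lt_of_le (Nat.lt_succ_self _) ((le_max_right _ _).trans hpM))
        convert this using 2
        rw [Finset.sum_filter]
        refine Finset.sum_congr rfl fun y _ => ?_
        rw [ite_not, evalRed, div_eq_mul_inv]
        rfl
    have h8 : 0 ≤ (2 * √M) * √(p : ℝ) := by positivity
    nlinarith [mul_nonneg hD0 (sub_nonneg.mpr hs1)]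

theorem norm_twoAvg2_sub_le {p : ℕ} [Fact p.Prime] (P : RatFunc ℚ) (K : ℝ)
    (hK : ∀ ψ : AddChar (ZMod p) ℂ,
      ‖∑ y with ¬ IsPole p P y, ψ (evalRed p P y) - ∑ a, ψ a‖ ≤ K)
    (f0 f1 : ZMod p × ZMod p → ℂ) (h0 : OneBounded f0) (h1 : OneBounded f1) :
    ‖twoAvg2 p P f0 f1 -
        (p : ℂ)⁻¹ ^ 2 * ∑ x1 : ZMod p, ∑ x2 : ZMod p,
          f0 (x1, x2) * ((p : ℂ)⁻¹ * ∑ a : ZMod p, f1 (x1, a))‖ ≤ K / p := by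
  have hp0 : (0 : ℝ) < p := by exact_mod_cast (Fact.out : p.Prime).pos
  have e : twoAvg2 p P f0 f1 -
        (p : ℂ)⁻¹ ^ 2 * ∑ x1 : ZMod p, ∑ x2 : ZMod p,
          f0 (x1, x2) * ((p : ℂ)⁻¹ * ∑ a : ZMod p, f1 (x1, a)) =
      (p : ℂ)⁻¹ ^ 3 * ∑ x1 : ZMod p,
        (∑ x2, ∑ y with ¬ IsPole p P y, f0 (x1, x2) * f1 (x1, x2 + evalRed p P y) -
          ∑ x2, f0 (x1, x2) * ∑ a, f1 (x1, a)) := by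
    rw [twoAvg2, Finset.sum_sub_distrib, mul_sub]
    simp only [Finset.sum_filter]
    congr 1
    simp only [Finset.mul_sum (Finset.univ : Finset (ZMod p))]
    refine Finset.sum_congr rfl fun x1 _ => Finset.sum_congr rfl fun x2 _ =>
      Finset.sum_congr rfl fun a _ => ?_
    ring
  rw [e, norm_mul, norm_pow, norm_inv, Complex.norm_natCast]
  have hs : ‖∑ x1 : ZMod p,
        (∑ x2, ∑ y with ¬ IsPole p P y, f0 (x1, x2) * f1 (x1, x2 + evalRed p P y) -
          ∑ x2, f0 (x1, x2) * ∑ a, f1 (x1, a))‖ ≤ p * (K * p) := by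
    calc _ ≤ ∑ x1 : ZMod p, K * p := by
          refine (norm_sum_le _ _).trans (Finset.sum_le_sum fun x1 _ => ?_)
          exact norm_correlation_sub_le _ (evalRed p P) K hK (fun x => f0 (x1, x))
            (fun x => f1 (x1, x)) (fun x => h0 _) fun x => h1 _
      _ = p * (K * p) := by simp
  calc _ ≤ (p : ℝ)⁻¹ ^ 3 * (p * (K * p)) := mul_le_mul_of_nonneg_left hs (by positivity)
    _ = K / p := by field_simp

/-- **Proposition 5.3.(2).** Asymptotic formula for two-term progressions in the second
coordinate. -/
theorem two_term_second (P : RatFunc ℚ) (hP : ∀ c : ℚ, P ≠ RatFunc.C c) :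
    ∃ C : ℝ, 0 < C ∧ ∀ (p : ℕ) [Fact p.Prime], Admissible p P →
      ∀ f0 f1 : ZMod p × ZMod p → ℂ, OneBounded f0 → OneBounded f1 →
        ‖twoAvg2 p P f0 f1 -
            (p : ℂ)⁻¹ ^ 2 * ∑ x1 : ZMod p, ∑ x2 : ZMod p,
              f0 (x1, x2) * ((p : ℂ)⁻¹ * ∑ a : ZMod p, f1 (x1, a))‖ ≤
          C * (p : ℝ) ^ (-(1 : ℝ) / 2) := by
  obtain ⟨K, hK, hKP⟩ := norm_sum_addChar_evalRed_sub_le P hP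
  refine ⟨K, hK, fun p _ hadm f0 f1 h0 h1 => ?_⟩
  refine (norm_twoAvg2_sub_le P _ (hKP p hadm) f0 f1 h0 h1).trans (le_of_eq ?_)
  have hp0 : (0 : ℝ) < p := by exact_mod_cast (Fact.out : p.Prime).pos
  rw [mul_div_assoc, Real.sqrt_eq_rpow]
  congr 1
  nth_rewrite 2 [← Real.rpow_one (p : ℝ)]
  rw [← Real.rpow_sub hp0]
  norm_num
end RatCorners
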